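/- arXiv:math/0505467 — 2 statements merged into one kernel-verified Lean document; each statement's English description precedes it below -/
import Mathlib

section
/- Let K be a field, P_0 = K[x_1,…,x_m], P = K[x_1,…,x_m,y_1,…,y_n] bigraded with deg x_i = (1,0) and deg y_j = (0,1), and P_+ = (y_1,…,y_n). Let M be a finitely generated bigraded P-module with dim_{P_0} M/P_+M ≤ 1. Then the function f_{n,M}(j) = reg H^n_{P_+}(M)_j is bounded above: there is a constant c such that reg H^n_{P_+}(M)_j ≤ c for all j ≪ 0. -/
/-!
Formalization of a statement from "On the regularity of local cohomology of bigraded algebras"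
(A. Rahimi). Here `P₀ = K[x₁,…,x_m]`, `P = P₀[y₁,…,yₙ]` is bigraded with `deg xᵢ = (1,0)`,
`deg yⱼ = (0,1)`, and `P₊ = (y₁,…,yₙ)`.  The top local cohomology `H^n_{P₊}(P)` is the free
`P₀`-module `⊕_c P₀ z^c` (`c : Fin n →₀ ℕ`, `z^c` of bidegree `(0, -n - |c|)`), on which a
bihomogeneous `f = Σ_β f_β y^β ∈ P` acts by the contraction `f ⬝ z^c = Σ_{β ≤ c} f_β z^{c-β}`.
For a hypersurface ring `R = P/fP` this yields the exact presentation
`⊕_{|c| = -n-j+b} P₀(-a) z^c → ⊕_{|c| = -n-j} P₀ z^c → H^n_{P₊}(R)_j → 0`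
(with `(a,b) = bideg f`), and `H^{n-1}_{P₊}(R)_j` is the kernel of the first map.
-/

open MvPolynomial

namespace Paper

/-- Total degree of an exponent vector. -/
def tdeg {n : ℕ} (c : Fin n →₀ ℕ) : ℕ := c.sum fun _ e => e

variable (A : Type) [CommRing A] (n : ℕ)

/-- The underlying module of the top local cohomology `H^n_{P₊}(P)` of `P = A[y₁,…,yₙ]`:
the free `A`-module with basis `z^c`, `c : Fin n →₀ ℕ` (`z^c` lies in `y`-degree `-n - |c|`). -/
abbrev Wmod := (Fin n →₀ ℕ) →₀ A

/-- The free `A`-submodule of `Wmod` spanned by the `z^c` with `|c| = k`;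
this is the graded component `H^n_{P₊}(P)_j` for `j = -n-k`. -/
noncomputable def Fk (k : ℕ) : Submodule A (Wmod A n) :=
  Finsupp.supported A A {c | tdeg c = k}

open scoped Classical in
/-- The contraction action of `f ∈ P = A[y₁,…,yₙ]` on `H^n_{P₊}(P)`:
`f ⬝ z^c = Σ_{β ≤ c} f_β z^{c-β}`, where `f = Σ_β f_β y^β` with `f_β ∈ A`. -/
noncomputable def contract (f : MvPolynomial (Fin n) A) :
    Wmod A n →ₗ[A] Wmod A n :=
  Finsupp.lsum A fun c =>
    (LinearMap.id : A →ₗ[A] A).smulRight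
      (f.support.sum fun β => if β ≤ c then Finsupp.single (c - β) (MvPolynomial.coeff β f) else 0)

section Resolutions

variable (A : Type) [CommRing A] (n : ℕ)

/-- The underlying module of `H^n_{P₊}(⊕_{s : σ} P)`, for `P = A[y₁,…,yₙ]`: the free
`A`-module with basis `z^c` in each summand, i.e. with basis indexed by `σ × (Fin n →₀ ℕ)`. -/
abbrev Emod (σ : Type) := (σ × (Fin n →₀ ℕ)) →₀ A

/-- The map induced on top local cohomology `H^n_{P₊}(-)` by a `P`-linear map
`φ : ⊕_{s' : σ'} P → ⊕_{s : σ} P` of free `P`-modules, `P = A[y₁,…,yₙ]`: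
`H^n_{P₊}(F) = F ⊗_P H^n_{P₊}(P)`, and the matrix entries of `φ` act by contraction. -/
noncomputable def emap {σ' σ : Type}
    (φ : (σ' →₀ MvPolynomial (Fin n) A) →ₗ[MvPolynomial (Fin n) A]
      (σ →₀ MvPolynomial (Fin n) A)) :
    Emod A n σ' →ₗ[A] Emod A n σ :=
  Finsupp.lsum A fun p =>
    (LinearMap.id : A →ₗ[A] A).smulRight
      ((φ (Finsupp.single p.1 1)).support.sum fun s =>
        Finsupp.mapDomain (fun c => (s, c))
          (contract A n ((φ (Finsupp.single p.1 1)) s) (Finsupp.single p.2 1)))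

/-- The `y`-degree-`j` strand of `H^n_{P₊}(⊕_{s : σ} P(•, -bdeg s))`: in the summand indexed
by `s`, the basis element `z^c` has `y`-degree `-n - |c| + bdeg s`. -/
def ystrand {σ : Type} (bdeg : σ → ℤ) (j : ℤ) : Submodule A (Emod A n σ) where
  carrier := {w | ∀ s c, w (s, c) ≠ 0 → (tdeg c : ℤ) = bdeg s - n - j}
  add_mem' := by
    intro a b ha hb s c h
    rw [Finsupp.add_apply] at h
    by_cases h1 : a (s, c) ≠ 0
    · exact ha s c h1
    · push_neg at h1
      exact hb s c (by simpa [h1] using h)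
  zero_mem' := by intro s c h; simp at h
  smul_mem' := by
    intro p w hw s c h
    rw [Finsupp.smul_apply] at h
    exact hw s c (right_ne_zero_of_smul h)

/-- The cycles, at homological position `i`, of the complex obtained by applying
`H^n_{P₊}(-)` to a graded free resolution `⋯ → F₁ → F₀` (with `Fᵢ = ⊕_{σ i} P`). -/
noncomputable def hKer (σ : ℕ → Type)
    (φ : ∀ i, ((σ (i + 1)) →₀ MvPolynomial (Fin n) A) →ₗ[MvPolynomial (Fin n) A]
      ((σ i) →₀ MvPolynomial (Fin n) A)) :
    ∀ i, Submodule A (Emod A n (σ i))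
  | 0 => ⊤
  | i + 1 => LinearMap.ker (emap A n (φ i))

/-- The `y`-degree-`j` component of `H_i(H^n_{P₊}(F))`, which by Theorem 1.1 of the paper
is the component `H^{n-i}_{P₊}(M)_j` of local cohomology when `F` is a graded free
resolution of `M`: the image of the degree-`j` cycles in the quotient by the boundaries. -/
noncomputable def Hy (σ : ℕ → Type)
    (φ : ∀ i, ((σ (i + 1)) →₀ MvPolynomial (Fin n) A) →ₗ[MvPolynomial (Fin n) A]
      ((σ i) →₀ MvPolynomial (Fin n) A))
    (bdeg : ∀ i, σ i → ℤ) (i : ℕ) (j : ℤ) :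
    Submodule A ((Emod A n (σ i)) ⧸ LinearMap.range (emap A n (φ i))) :=
  Submodule.map (LinearMap.range (emap A n (φ i))).mkQ
    (hKer A n σ φ i ⊓ ystrand A n (bdeg i) j)

end Resolutions

section CMregularity

variable (K : Type) [Field K] (m : ℕ)
variable (N : Type) [AddCommGroup N] [Module (MvPolynomial (Fin m) K) N]
  [Module K N] [IsScalarTower K (MvPolynomial (Fin m) K) N]

/-- The Koszul differential on `x₁,…,x_m` with values in the `P₀ = K[x₁,…,x_m]`-module `N`;
the Koszul complex on `x₁,…,x_m` is a graded free resolution of `K` over `P₀`, so its homology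
with values in `N` computes the graded modules `Tor_i^{P₀}(N, K)`. -/
noncomputable def kosD (i : ℕ) :
    ({S : Finset (Fin m) // S.card = i + 1} →₀ N) →ₗ[MvPolynomial (Fin m) K]
      ({S : Finset (Fin m) // S.card = i} →₀ N) :=
  Finsupp.lsum (MvPolynomial (Fin m) K) fun S =>
    S.1.attach.sum fun l =>
      ((-1 : ℤ) ^ (S.1.filter (fun l' => l' < l.1)).card) •
        ((Finsupp.lsingle (⟨S.1.erase l.1, by
            simp [Finset.card_erase_of_mem l.2, S.2]⟩ :
            {T : Finset (Fin m) // T.card = i})).comp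
          (LinearMap.lsmul (MvPolynomial (Fin m) K) N (MvPolynomial.X l.1)))

/-- The cycles of the Koszul complex with values in `N` at homological degree `i`. -/
noncomputable def kosKer : ∀ i : ℕ,
    Submodule (MvPolynomial (Fin m) K) ({S : Finset (Fin m) // S.card = i} →₀ N)
  | 0 => ⊤
  | i + 1 => LinearMap.ker (kosD K m N i)

/-- The (internal) degree-`e` strand of the `i`-th Koszul module (the basis element `e_S`,
`|S| = i`, has internal degree `i`), relative to a grading `ℬ` of `N`. -/
def kosStrand (ℬ : ℤ → Submodule K N) (i : ℕ) (e : ℤ) :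
    Submodule K ({S : Finset (Fin m) // S.card = i} →₀ N) where
  carrier := {w | ∀ S, w S ∈ ℬ (e - i)}
  add_mem' := by
    intro a b ha hb S
    rw [Finsupp.add_apply]
    exact add_mem (ha S) (hb S)
  zero_mem' := by intro S; simp
  smul_mem' := by
    intro k w hw S
    rw [Finsupp.smul_apply]
    exact Submodule.smul_mem _ _ (hw S)

/-- The Castelnuovo–Mumford regularity over `P₀ = K[x₁,…,x_m]` of a finitely generated
graded `P₀`-module `N` with grading `ℬ`:
`reg N = max { e : Tor_i^{P₀}(N, K)_{e+i} ≠ 0 for some i }`, where the graded `Tor` modules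
are computed as the homology of the graded Koszul complex on `x₁,…,x_m` with values in `N`. -/
noncomputable def CMreg (ℬ : ℤ → Submodule K N) : ℤ :=
  sSup {e : ℤ | ∃ i : ℕ,
    Submodule.map ((LinearMap.range (kosD K m N i)).mkQ.restrictScalars K)
      (kosStrand K m N ℬ i (e + i) ⊓ (kosKer K m N i).restrictScalars K) ≠ ⊥}

end CMregularity

section BigradedResolutions

variable (K : Type) [Field K] (m n : ℕ)

/-- `f ∈ P = K[x₁,…,x_m][y₁,…,yₙ]` is bihomogeneous of bidegree `(a,b)`:
every monomial `x^ν y^β` occurring in `f` has `|ν| = a` and `|β| = b`. -/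
def IsBihom (f : MvPolynomial (Fin n) (MvPolynomial (Fin m) K)) (a b : ℕ) : Prop :=
  ∀ β ν, MvPolynomial.coeff ν (MvPolynomial.coeff β f) ≠ 0 → tdeg ν = a ∧ tdeg β = b

/-- The `x`-degree-`d` strand of `H^n_{P₊}(⊕_{s : σ} P(-adeg s, •))`: in the summand indexed
by `s`, the coefficients of `z^c` must be homogeneous of degree `d - adeg s`. -/
def xstrandE {σ : Type} (adeg : σ → ℤ) (d : ℤ) :
    Submodule K (Emod (MvPolynomial (Fin m) K) n σ) where
  carrier := {w | ∀ s c ν, MvPolynomial.coeff ν (w (s, c)) ≠ 0 → (tdeg ν : ℤ) = d - adeg s}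
  add_mem' := by
    intro a b ha hb s c ν h
    rw [Finsupp.add_apply, MvPolynomial.coeff_add] at h
    by_cases h1 : MvPolynomial.coeff ν (a (s, c)) ≠ 0
    · exact ha s c ν h1
    · push_neg at h1
      exact hb s c ν (by simpa [h1] using h)
  zero_mem' := by intro s c ν h; simp at h
  smul_mem' := by
    intro k w hw s c ν h
    rw [Finsupp.smul_apply, MvPolynomial.coeff_smul] at h
    exact hw s c ν (right_ne_zero_of_smul h)

/-- The `x`-grading of the `y`-degree-`j` component `H^{n-i}_{P₊}(M)_j = H_i(H^n_{P₊}(F))_j`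
of local cohomology, computed from a bigraded free resolution `F` of `M` with bidegree
twists `D`. -/
noncomputable def HyGr (σ : ℕ → Type)
    (φ : ∀ i, ((σ (i + 1)) →₀ MvPolynomial (Fin n) (MvPolynomial (Fin m) K))
      →ₗ[MvPolynomial (Fin n) (MvPolynomial (Fin m) K)]
      ((σ i) →₀ MvPolynomial (Fin n) (MvPolynomial (Fin m) K)))
    (D : ∀ i, σ i → ℤ × ℤ) (i : ℕ) (j : ℤ) (d : ℤ) :
    Submodule K ↥(Hy (MvPolynomial (Fin m) K) n σ φ (fun i s => (D i s).2) i j) :=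
  Submodule.comap
    ((Hy (MvPolynomial (Fin m) K) n σ φ (fun i s => (D i s).2) i j).subtype.restrictScalars K)
    (Submodule.map
      ((LinearMap.range (emap (MvPolynomial (Fin m) K) n (φ i))).mkQ.restrictScalars K)
      (Submodule.restrictScalars K
          (hKer (MvPolynomial (Fin m) K) n σ φ i ⊓
            ystrand (MvPolynomial (Fin m) K) n (fun s => ((D i s).2 : ℤ)) j) ⊓
        xstrandE K m n (fun s => (D i s).1) d))

end BigradedResolutions

end Paper

namespace Paper

set_option linter.unusedSectionVars false


section Koszul

variable (K : Type) [Field K] (m : ℕ)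
variable (N : Type) [AddCommGroup N] [Module (MvPolynomial (Fin m) K) N]
  [Module K N] [IsScalarTower K (MvPolynomial (Fin m) K) N]

/-- Koszul sign. -/
def ksgn {m : ℕ} (S : Finset (Fin m)) (a : Fin m) : ℤ :=
  (-1 : ℤ) ^ (S.filter (fun l' => l' < a)).card

lemma ksgn_mul_self {m : ℕ} (S : Finset (Fin m)) (a : Fin m) : ksgn S a * ksgn S a = 1 := by
  unfold ksgn
  rw [← mul_pow]; simp

lemma ksgn_insert_self {m : ℕ} (S : Finset (Fin m)) (a : Fin m) :
    ksgn (insert a S) a = ksgn S a := by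
  unfold ksgn
  rw [Finset.filter_insert]; simp

lemma ksgn_erase_self {m : ℕ} (S : Finset (Fin m)) (a : Fin m) :
    ksgn (S.erase a) a = ksgn S a := by
  by_cases h : a ∈ S
  · conv_rhs => rw [← Finset.insert_erase h]
    rw [ksgn_insert_self]
  · rw [Finset.erase_eq_of_notMem h]

lemma ksgn_insert {m : ℕ} (S : Finset (Fin m)) (a l : Fin m) (ha : a ∉ S) :
    ksgn (insert a S) l = if a < l then - ksgn S l else ksgn S l := by
  unfold ksgn
  rw [Finset.filter_insert]
  split_ifs with h
  · rw [Finset.card_insert_of_notMem (by simp [ha]), pow_succ]; simp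
  · rfl

lemma ksgn_swap {m : ℕ} (T : Finset (Fin m)) (a l : Fin m) (hl : l ∈ T) (ha : a ∉ T) :
    ksgn T a * ksgn (insert a T) l = - (ksgn T l * ksgn (T.erase l) a) := by
  have h1 := ksgn_insert T a l ha
  have h2 := ksgn_insert (T.erase l) l a (by simp)
  rw [Finset.insert_erase hl] at h2
  have hne : a ≠ l := fun h => ha (h ▸ hl)
  rw [h1, h2]
  rcases lt_or_gt_of_ne hne with h | h
  · simp [h, not_lt_of_gt h, mul_comm]
  · simp [h, not_lt_of_gt h, mul_comm]

lemma kosD_apply (i : ℕ) (w : {S : Finset (Fin m) // S.card = i + 1} →₀ N)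
    (T : {S : Finset (Fin m) // S.card = i}) :
    kosD K m N i w T = ∑ a : {a : Fin m // a ∉ T.1},
      ksgn T.1 a.1 • ((X a.1 : MvPolynomial (Fin m) K) •
        w ⟨insert a.1 T.1, by rw [Finset.card_insert_of_notMem a.2, T.2]⟩) := by
  classical
  induction w using Finsupp.induction_linear with
  | zero => simp
  | add f g hf hg => 
    rw [map_add, Finsupp.add_apply, hf, hg, ← Finset.sum_add_distrib]
    simp only [Finsupp.add_apply, smul_add]
  | single S n =>
    unfold kosD
    rw [Finsupp.lsum_single]
    simp only [LinearMap.sum_apply, Finsupp.finsetSum_apply, LinearMap.smul_apply,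
      LinearMap.comp_apply, Finsupp.smul_apply, Finsupp.lsingle_apply, LinearMap.lsmul_apply,
      Finsupp.single_apply]
    by_cases hST : ∃ a, a ∉ T.1 ∧ insert a T.1 = S.1
    · obtain ⟨a, ha, hS⟩ := hST
      have haS : a ∈ S.1 := by rw [← hS]; simp
      rw [Finset.sum_eq_single ⟨a, haS⟩, Finset.sum_eq_single ⟨a, ha⟩]
      · have e1 : S.1.erase a = T.1 := by rw [← hS, Finset.erase_insert ha]
        rw [if_pos (Subtype.ext e1), if_pos (Subtype.ext hS.symm)]
        congr 1
        rw [← ksgn_insert_self, hS]; rfl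
      · rintro ⟨b, hb⟩ - hne
        rw [if_neg]; · simp
        intro h
        have h := congrArg Subtype.val h
        simp only at h
        apply hne
        have : b ∈ insert a T.1 := by rw [hS, h]; simp
        rcases Finset.mem_insert.1 this with h | h
        · exact Subtype.ext h
        · exact absurd h hb
      · intro h; exact absurd (Finset.mem_univ _) h
      · rintro ⟨b, hb⟩ - hne
        rw [if_neg]; · simp
        intro h
        have h := congrArg Subtype.val h
        simp only at h
        apply hne
        have : a ∉ S.1.erase b := by rw [h]; exact ha
        simp only [Finset.mem_erase, not_and] at this
        by_contra h'
        exact this (fun h'' => h' (Subtype.ext h''.symm)) haS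
      · intro h; exact absurd (Finset.mem_attach _ _) h
    · rw [Finset.sum_eq_zero, Finset.sum_eq_zero]
      · rintro ⟨b, hb⟩ -
        rw [if_neg]; · simp
        intro h
        exact hST ⟨b, hb, (congrArg Subtype.val h).symm⟩
      · rintro ⟨b, hb⟩ -
        rw [if_neg]; · simp
        intro h
        have h := congrArg Subtype.val h
        simp only at h
        exact hST ⟨b, by rw [← h]; simp, by rw [← h, Finset.insert_erase hb]⟩

lemma kos_X_smul (i : ℕ) (l : Fin m) (w : {S : Finset (Fin m) // S.card = i} →₀ N)
    (hw : w ∈ kosKer K m N i) :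
    (X l : MvPolynomial (Fin m) K) • w ∈ LinearMap.range (kosD K m N i) := by
  classical
  refine ⟨Finsupp.equivFunOnFinite.symm (fun S => if h : l ∈ S.1 then
    ksgn S.1 l • w ⟨S.1.erase l, by rw [Finset.card_erase_of_mem h, S.2]; rfl⟩ else 0), ?_⟩
  ext T
  rw [kosD_apply]
  simp only [Finsupp.equivFunOnFinite_symm_apply_apply, Finsupp.smul_apply]
  by_cases hl : l ∈ T.1
  · obtain ⟨T, hT⟩ := T
    simp only at hl
    obtain ⟨i, rfl⟩ : ∃ i', i = i' + 1 := by
      cases i with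
      | zero => rw [Finset.card_eq_zero] at hT; simp [hT] at hl
      | succ i => exact ⟨i, rfl⟩
    have hc : (T.erase l).card = i := by rw [Finset.card_erase_of_mem hl, hT]; rfl
    have h0 : kosD K m N i w ⟨T.erase l, hc⟩ = 0 := by
      have : kosD K m N i w = 0 := hw
      rw [this]; rfl
    rw [kosD_apply] at h0
    simp only at h0
    rw [← Finset.add_sum_erase _ _ (Finset.mem_univ (⟨l, by simp⟩ : {a // a ∉ T.erase l}))] at h0
    have key : ∑ x : {a // a ∉ T}, ksgn T x.1 • (X x.1 : MvPolynomial (Fin m) K) •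
        (if h : l ∈ insert x.1 T then
          ksgn (insert x.1 T) l • w ⟨(insert x.1 T).erase l, by
            rw [Finset.card_erase_of_mem h, Finset.card_insert_of_notMem x.2, hT]; rfl⟩
          else 0)
        = - (ksgn T l • ∑ x ∈ (Finset.univ.erase (⟨l, by simp⟩ : {a // a ∉ T.erase l})),
          ksgn (T.erase l) x.1 • (X x.1 : MvPolynomial (Fin m) K) •
            w ⟨insert x.1 (T.erase l), by rw [Finset.card_insert_of_notMem x.2, hc]⟩) := by
      rw [Finset.smul_sum, ← Finset.sum_neg_distrib]
      refine Finset.sum_bij (fun a _ => ⟨a.1, fun h => a.2 (Finset.mem_of_mem_erase h)⟩) ?_ ?_ ?_ ?_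
      · intro a _
        simp only [Finset.mem_erase, Finset.mem_univ, and_true, ne_eq, Subtype.mk.injEq]
        exact fun h => a.2 (h ▸ hl)
      · intro a _ b _ h
        simpa [Subtype.ext_iff] using h
      · rintro ⟨b, hb⟩ hb'
        simp only [Finset.mem_erase, Finset.mem_univ, and_true, ne_eq, Subtype.mk.injEq] at hb'
        exact ⟨⟨b, fun h => hb (Finset.mem_erase.2 ⟨hb', h⟩)⟩, Finset.mem_univ _, rfl⟩
      · rintro ⟨a, ha⟩ _
        have hal : a ≠ l := fun h => ha (h ▸ hl)
        rw [dif_pos (Finset.mem_insert_of_mem hl)]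
        have e : (insert a T).erase l = insert a (T.erase l) := Finset.erase_insert_of_ne hal
        simp only [e]
        rw [smul_comm (X a : MvPolynomial (Fin m) K) (ksgn (insert a T) l), smul_smul,
          ksgn_swap T a l hl ha, neg_smul, smul_smul]
    refine key.trans ?_
    rw [add_comm] at h0
    rw [eq_neg_of_add_eq_zero_left h0, smul_neg, neg_neg, smul_smul, ksgn_erase_self,
      ksgn_mul_self, one_smul]
    simp only [Finset.insert_erase hl]
  · rw [Finset.sum_eq_single ⟨l, hl⟩]
    · simp only [Finset.mem_insert_self, dif_pos]
      rw [smul_comm (X l : MvPolynomial (Fin m) K), smul_smul, ksgn_insert_self,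
      ksgn_mul_self, one_smul]
      simp only [Finset.erase_insert hl]
    · rintro ⟨b, hb⟩ - hne
      rw [dif_neg]; · simp
      simp only [Finset.mem_insert, not_or]
      exact ⟨fun h => hne (Subtype.ext h.symm), hl⟩
    · intro h; exact absurd (Finset.mem_univ _) h

lemma CMreg_le (ℬ : ℤ → Submodule K N) (g : MvPolynomial (Fin m) K)
    (hg : g ∈ Ideal.span (Set.range (X : Fin m → MvPolynomial (Fin m) K)))
    (r : ℕ) (d1 : ℤ)
    (hX : ∀ l d n, n ∈ ℬ d → (X l : MvPolynomial (Fin m) K) • n ∈ ℬ (d + 1))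
    (hs : ∀ d, d1 ≤ d → ∀ n ∈ ℬ d, ∃ n' ∈ ℬ (d - r), g • n' = n)
    (hi : ∀ d, d1 ≤ d → ∀ n ∈ ℬ d, g • n = 0 → n = 0) :
    CMreg K m N ℬ ≤ max 0 (d1 + r) := by
  classical
  unfold CMreg
  set A := {e : ℤ | ∃ i : ℕ,
    Submodule.map ((LinearMap.range (kosD K m N i)).mkQ.restrictScalars K)
      (kosStrand K m N ℬ i (e + i) ⊓ (kosKer K m N i).restrictScalars K) ≠ ⊥} with hA
  rcases A.eq_empty_or_nonempty with h | h
  · rw [h]; simp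
  refine (csSup_le h ?_).trans (le_max_right _ _)
  rintro e ⟨i, hei⟩
  by_contra hlt
  push Not at hlt
  apply hei
  rw [eq_bot_iff]
  rintro _ ⟨w, ⟨hw1, hw2⟩, rfl⟩
  have hw1' : ∀ S, w S ∈ ℬ e := by
    intro S
    have := hw1 S
    rwa [add_sub_cancel_right] at this
  choose f hf hf' using fun S => hs e (by omega) (w S) (hw1' S)
  set w' : {S : Finset (Fin m) // S.card = i} →₀ N := Finsupp.equivFunOnFinite.symm f with hw'
  have hgw : g • w' = w := by
    ext S; simp [hw', hf']
  have hk : w' ∈ kosKer K m N i := by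
    cases i with
    | zero => exact Submodule.mem_top
    | succ i =>
      change kosD K m N i w' = 0
      ext T
      refine hi (e - r + 1) (by omega) _ ?_ ?_
      · rw [kosD_apply]
        refine Submodule.sum_mem _ fun a _ => ?_
        refine zsmul_mem (hX _ _ _ ?_) _
        simpa [hw'] using hf _
      · rw [← Finsupp.smul_apply, ← map_smul, hgw]
        have : kosD K m N i w = 0 := hw2
        rw [this]; rfl
  rw [Submodule.mem_bot]
  change (LinearMap.range (kosD K m N i)).mkQ w = 0
  rw [Submodule.mkQ_apply, Submodule.Quotient.mk_eq_zero, ← hgw]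
  clear_value w'
  clear hgw hei hw' hs hi hf'
  induction hg using Submodule.span_induction with
  | mem x hx => obtain ⟨l, rfl⟩ := hx; exact kos_X_smul K m N i l w' hk
  | zero => simp
  | add x y _ _ hx hy => rw [add_smul]; exact add_mem hx hy
  | smul a x _ hx => rw [smul_assoc]; exact Submodule.smul_mem _ _ hx

end Koszul

section RingPart

attribute [local instance] MvPolynomial.gradedAlgebra

variable {K : Type} [Field K] {m : ℕ}

lemma hom_le_vars (q : Ideal (MvPolynomial (Fin m) K)) (hq : q ≠ ⊤)
    (hh : q.IsHomogeneous (homogeneousSubmodule (Fin m) K)) : q ≤ idealOfVars (Fin m) K := by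
  intro f hf
  rw [← pow_one (idealOfVars (Fin m) K), mem_pow_idealOfVars_iff']
  intro x hx
  have hx0 : x = 0 := by
    rw [← Finsupp.degree_eq_zero_iff]; omega
  subst hx0
  by_contra hne
  apply hq
  have := homogeneousComponent_mem_of_mem hh hf 0
  rw [homogeneousComponent_zero] at this
  refine Ideal.eq_top_of_isUnit_mem _ this ?_
  exact (isUnit_iff_ne_zero.2 hne).map C

lemma vars_ne_top : idealOfVars (Fin m) K ≠ ⊤ := by
  rw [Ne, Ideal.eq_top_iff_one]
  rw [← pow_one (idealOfVars (Fin m) K), mem_pow_idealOfVars_iff']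
  intro h
  have := h 0 (by simp)
  simp at this

lemma vars_prime : (idealOfVars (Fin m) K).IsPrime := by
  have hmax : (idealOfVars (Fin m) K).IsMaximal := by
    rw [Ideal.isMaximal_def]
    refine ⟨vars_ne_top, fun J hJ => ?_⟩
    obtain ⟨f, hfJ, hf⟩ := SetLike.exists_of_lt hJ
    rw [← pow_one (idealOfVars (Fin m) K), mem_pow_idealOfVars_iff'] at hf
    push Not at hf
    obtain ⟨x, hx, hx'⟩ := hf
    have hx0 : x = 0 := by
      rw [← Finsupp.degree_eq_zero_iff]; omega
    subst hx0
    have h1 : f - C (coeff 0 f) ∈ idealOfVars (Fin m) K := by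
      rw [← pow_one (idealOfVars (Fin m) K), mem_pow_idealOfVars_iff']
      intro x hx
      have hx0 : x = 0 := by
        rw [← Finsupp.degree_eq_zero_iff]; omega
      subst hx0
      simp
    have h2 : C (coeff 0 f) ∈ J := by
      have := J.sub_mem hfJ (hJ.le h1)
      simpa using this
    exact Ideal.eq_top_of_isUnit_mem _ h2 ((isUnit_iff_ne_zero.2 hx').map C)
  exact hmax.isPrime

lemma minPrime_hom (I : Ideal (MvPolynomial (Fin m) K))
    (hI : I.IsHomogeneous (homogeneousSubmodule (Fin m) K))
    (p : Ideal (MvPolynomial (Fin m) K)) (hp : p ∈ I.minimalPrimes) :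
    p.IsHomogeneous (homogeneousSubmodule (Fin m) K) := by
  have h1 : (p.homogeneousCore (homogeneousSubmodule (Fin m) K)).toIdeal.IsPrime :=
    Ideal.IsPrime.homogeneousCore hp.1.1
  have h2 : I ≤ (p.homogeneousCore (homogeneousSubmodule (Fin m) K)).toIdeal := by
    rw [← hI.toIdeal_homogeneousCore_eq_self]
    exact Ideal.homogeneousCore_mono _ hp.1.2
  have h3 := hp.2 ⟨h1, h2⟩ (Ideal.toIdeal_homogeneousCore_le _ _)
  rw [Ideal.IsHomogeneous.iff_eq]
  exact le_antisymm (Ideal.toIdeal_homogeneousCore_le _ _) h3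

lemma exists_hom_notMem (J p : Ideal (MvPolynomial (Fin m) K))
    (hJ : J.IsHomogeneous (homogeneousSubmodule (Fin m) K))
    (h : ¬ J ≤ p) : ∃ f ∈ J, f ∉ p ∧ ∃ r, f.IsHomogeneous r := by
  obtain ⟨f, hf, hfp⟩ := SetLike.not_le_iff_exists.1 h
  by_contra hcon
  push Not at hcon
  apply hfp
  rw [← sum_homogeneousComponent f]
  refine Ideal.sum_mem _ fun i _ => ?_
  by_contra h'
  exact hcon _ (homogeneousComponent_mem_of_mem hJ hf i) h' i
    (homogeneousComponent_isHomogeneous i f)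

lemma exists_param (I : Ideal (MvPolynomial (Fin m) K))
    (hI : I.IsHomogeneous (homogeneousSubmodule (Fin m) K))
    (hdim : ringKrullDim (MvPolynomial (Fin m) K ⧸ I) ≤ 1) :
    ∃ (g : MvPolynomial (Fin m) K) (r t : ℕ), 0 < r ∧ g.IsHomogeneous r ∧
      g ∈ idealOfVars (Fin m) K ∧
      idealOfVars (Fin m) K ^ t ≤ I ⊔ Ideal.span {g} := by
  classical
  set 𝔪 := idealOfVars (Fin m) K with h𝔪
  have hmh : 𝔪.IsHomogeneous (homogeneousSubmodule (Fin m) K) := by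
    apply Ideal.homogeneous_span
    rintro _ ⟨i, rfl⟩
    exact ⟨1, isHomogeneous_X K i⟩
  have hfin := Ideal.finite_minimalPrimes_of_isNoetherianRing (MvPolynomial (Fin m) K) I
  set Q : Finset (Ideal (MvPolynomial (Fin m) K)) := hfin.toFinset.filter (fun p => p ≠ 𝔪) with hQ
  have hQmin : ∀ p ∈ Q, p ∈ I.minimalPrimes := by
    intro p hp; simp [hQ] at hp; exact hp.1
  have hQne : ∀ p ∈ Q, p ≠ 𝔪 := by
    intro p hp; simp [hQ] at hp; exact hp.2
  have hQprime : ∀ p ∈ Q, p.IsPrime := fun p hp => (hQmin p hp).1.1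
  have hQhom : ∀ p ∈ Q, p.IsHomogeneous (homogeneousSubmodule (Fin m) K) := fun p hp =>
    minPrime_hom I hI p (hQmin p hp)
  have hQle : ∀ p ∈ Q, p ≤ 𝔪 := fun p hp => hom_le_vars p (hQprime p hp).ne_top (hQhom p hp)
  have hex : ∀ p : Ideal (MvPolynomial (Fin m) K), ∃ f : MvPolynomial (Fin m) K, ∃ r : ℕ,
      p ∈ Q → (f ∈ 𝔪 ∧ (∀ q ∈ Q, q ≠ p → f ∈ q) ∧ f ∉ p ∧ 0 < r ∧ f.IsHomogeneous r) := by
    intro p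
    by_cases hp : p ∈ Q
    swap
    · exact ⟨0, 0, fun h => absurd h hp⟩
    have hJh : (𝔪 ⊓ ⨅ q ∈ Q.erase p, q).IsHomogeneous (homogeneousSubmodule (Fin m) K) := by
      refine hmh.inf (Ideal.IsHomogeneous.iInf₂ fun q hq => hQhom q (Finset.mem_of_mem_erase hq))
    have hnot : ¬ (𝔪 ⊓ ⨅ q ∈ Q.erase p, q) ≤ p := by
      intro hle

      rcases (Ideal.IsPrime.inf_le (hQprime p hp)).1 hle with h | h
      · exact hQne p hp (le_antisymm (hQle p hp) h)
      · rw [← Finset.inf_eq_iInf, Ideal.IsPrime.inf_le' (hQprime p hp)] at h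
        obtain ⟨q, hq, hqp⟩ := h
        have hqQ := Finset.mem_of_mem_erase hq
        have := (hQmin p hp).2 ⟨hQprime q hqQ, (hQmin q hqQ).1.2⟩ hqp
        exact (Finset.ne_of_mem_erase hq) (le_antisymm hqp this)
    obtain ⟨f, hf, hfp, r, hr⟩ := exists_hom_notMem _ p hJh hnot
    refine ⟨f, r, fun _ => ⟨hf.1, ?_, hfp, ?_, hr⟩⟩
    · intro q hq hqp
      have := hf.2
      simp only [SetLike.mem_coe, Submodule.mem_iInf] at this
      exact this q (Finset.mem_erase.2 ⟨hqp, hq⟩)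
    · by_contra h0
      have h0 : r = 0 := by omega
      subst h0
      have hf1 := hf.1
      rw [SetLike.mem_coe, h𝔪, ← pow_one (idealOfVars (Fin m) K), mem_pow_idealOfVars_iff'] at hf1
      apply hfp
      have : f = 0 := by
        ext x
        by_cases hx : x.degree = 0
        · rw [hf1 x (by omega)]; simp
        · rw [hr.coeff_eq_zero hx]; simp
      rw [this]; exact zero_mem _
  choose f r hfr using hex
  set R := ∏ p ∈ Q, r p with hR
  have hRpos : 0 < R := Finset.prod_pos fun p hp => (hfr p hp).2.2.2.1
  set g := ∑ p ∈ Q, f p ^ (R / r p) with hg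
  have hexp : ∀ p ∈ Q, r p * (R / r p) = R := fun p hp =>
    Nat.mul_div_cancel' (Finset.dvd_prod_of_mem r hp)
  have hexp0 : ∀ p ∈ Q, R / r p ≠ 0 := by
    intro p hp h
    have := hexp p hp
    rw [h] at this; omega
  have hghom : g.IsHomogeneous R := by
    refine IsHomogeneous.sum _ _ _ fun p hp => ?_
    have := (hfr p hp).2.2.2.2.pow (R / r p)
    rwa [hexp p hp] at this
  have hgm : g ∈ 𝔪 := Ideal.sum_mem _ fun p hp =>
    Ideal.pow_mem_of_mem _ (hfr p hp).1 _ (Nat.pos_of_ne_zero (hexp0 p hp))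
  have hgp : ∀ p ∈ Q, g ∉ p := by
    intro p hp hmem
    rw [hg, ← Finset.add_sum_erase _ _ hp] at hmem
    have h2 : ∑ x ∈ Q.erase p, f x ^ (R / r x) ∈ p := by
      refine Ideal.sum_mem _ fun q hq => ?_
      have hqQ := Finset.mem_of_mem_erase hq
      exact Ideal.pow_mem_of_mem _ ((hfr q hqQ).2.1 p hp (Finset.ne_of_mem_erase hq).symm) _
        (Nat.pos_of_ne_zero (hexp0 q hqQ))
    have h3 := (Ideal.add_mem_iff_left _ h2).1 hmem
    exact (hfr p hp).2.2.1 ((hQprime p hp).mem_of_pow_mem _ h3)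
  have hJhom : (I ⊔ Ideal.span {g}).IsHomogeneous (homogeneousSubmodule (Fin m) K) := by
    refine hI.sup (Ideal.homogeneous_span _ _ ?_)
    intro x hx
    rw [Set.mem_singleton_iff] at hx
    subst hx
    exact ⟨R, hghom⟩
  have hrad : 𝔪 ≤ (I ⊔ Ideal.span {g}).radical := by
    rw [hJhom.radical_eq]
    refine le_sInf ?_
    rintro q ⟨hqh, hqle, hqp⟩
    have hqm : q ≤ 𝔪 := hom_le_vars q hqp.ne_top hqh
    by_contra hcon
    obtain ⟨p, hp, hpq⟩ := Ideal.exists_minimalPrimes_le (le_sup_left.trans hqle)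
    have hgq : g ∈ q := hqle (le_sup_right (a := I) (Ideal.mem_span_singleton_self g))
    have hpne : p ≠ 𝔪 := by rintro rfl; exact hcon hpq
    have hpQ : p ∈ Q := by simp [hQ, hpne, hp]
    have hlt1 : p < q := lt_of_le_of_ne hpq (by rintro rfl; exact hgp _ hpQ hgq)
    have hlt2 : q < 𝔪 := lt_of_le_not_ge hqm hcon
    rw [ringKrullDim_quotient] at hdim
    have hIp := hp.1.2
    let a : PrimeSpectrum.zeroLocus (R := MvPolynomial (Fin m) K) I :=
      ⟨⟨p, hp.1.1⟩, hIp⟩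
    let b : PrimeSpectrum.zeroLocus (R := MvPolynomial (Fin m) K) I :=
      ⟨⟨q, hqp⟩, hIp.trans hlt1.le⟩
    let c : PrimeSpectrum.zeroLocus (R := MvPolynomial (Fin m) K) I :=
      ⟨⟨𝔪, vars_prime⟩, hIp.trans (hlt1.le.trans hlt2.le)⟩
    have hab : a < b := hlt1
    have hbc : b < c := hlt2
    let L : LTSeries (PrimeSpectrum.zeroLocus (R := MvPolynomial (Fin m) K) I) :=
      { length := 2
        toFun := ![a, b, c]
        step := by
          intro i
          fin_cases i
          · exact hab
          · exact hbc }
    have h2 := (Order.LTSeries.length_le_krullDim L).trans hdim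
    have h3 : ((2 : ℕ) : WithBot ℕ∞) ≤ 1 := h2
    exact absurd h3 (by decide)
  obtain ⟨t, ht⟩ := Ideal.exists_pow_le_of_le_radical_of_fg hrad (idealOfVars_fg (Fin m) K)
  exact ⟨g, R, t, hRpos, hghom, hgm, ht⟩

end RingPart

section ModPart

attribute [local instance] MvPolynomial.gradedAlgebra

variable {K : Type} [Field K] {m n : ℕ}

lemma tdeg_eq_degree {n : ℕ} (c : Fin n →₀ ℕ) : tdeg c = c.degree := rfl

lemma isBihom_C (p : MvPolynomial (Fin m) K) (r : ℕ) (hp : p.IsHomogeneous r) :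
    IsBihom K m n (C p) r 0 := by
  classical
  intro β ν h
  rw [coeff_C] at h
  split_ifs at h with h0
  · subst h0
    refine ⟨?_, by simp [tdeg_eq_degree]⟩
    by_contra h'
    exact h (hp.coeff_eq_zero h')
  · simp at h

lemma isBihom_monomial (γ : Fin n →₀ ℕ) :
    IsBihom K m n (monomial γ 1) 0 (tdeg γ) := by
  classical
  intro β ν h
  rw [coeff_monomial] at h
  split_ifs at h with h0
  · subst h0
    rw [coeff_one] at h
    split_ifs at h with h0
    · subst h0; simp [tdeg_eq_degree]
    · simp at h
  · simp at h

lemma isBihom_X (i : Fin n) : IsBihom K m n (X i) 0 1 := by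
  have := isBihom_monomial (K := K) (m := m) (Finsupp.single i 1 : Fin n →₀ ℕ)
  rwa [tdeg_eq_degree, Finsupp.degree_single] at this

variable {M : Type} [AddCommGroup M]
    [Module K M]
    [Module (MvPolynomial (Fin n) (MvPolynomial (Fin m) K)) M]

variable (ℳ : ℤ × ℤ → Submodule K M) [DirectSum.Decomposition ℳ]

/-- Bigraded component. -/
noncomputable def cmp (v : ℤ × ℤ) : M →+ M where
  toFun x := (DirectSum.decompose ℳ x v : M)
  map_zero' := by simp
  map_add' x y := by simp

lemma cmp_mem (v : ℤ × ℤ) (x : M) : cmp ℳ v x ∈ ℳ v := (DirectSum.decompose ℳ x v).2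

lemma cmp_same {v : ℤ × ℤ} {x : M} (hx : x ∈ ℳ v) : cmp ℳ v x = x :=
  DirectSum.decompose_of_mem_same ℳ hx

lemma cmp_ne {v v' : ℤ × ℤ} {x : M} (hx : x ∈ ℳ v) (h : v ≠ v') : cmp ℳ v' x = 0 :=
  DirectSum.decompose_of_mem_ne ℳ hx h

/-- Compatibility of the bigrading with the action of the polynomial ring. -/
def SmulGr (K : Type) [Field K] (m n : ℕ) {M : Type} [AddCommGroup M] [Module K M]
    [Module (MvPolynomial (Fin n) (MvPolynomial (Fin m) K)) M]
    (ℳ : ℤ × ℤ → Submodule K M) : Prop :=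
  ∀ (a b : ℕ) (p : MvPolynomial (Fin n) (MvPolynomial (Fin m) K)),
      IsBihom K m n p a b →
      ∀ (v : ℤ × ℤ) (x : M), x ∈ ℳ v → p • x ∈ ℳ (v.1 + a, v.2 + b)

lemma cmp_smul (hsmul : SmulGr K m n ℳ) {a b : ℕ} {p : MvPolynomial (Fin n) (MvPolynomial (Fin m) K)}
    (hp : IsBihom K m n p a b) (v : ℤ × ℤ) (x : M) :
    cmp ℳ v (p • x) = p • cmp ℳ (v.1 - a, v.2 - b) x := by
  induction x using DirectSum.Decomposition.inductionOn ℳ with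
  | zero => simp
  | add x y hx hy => rw [smul_add, map_add, map_add, hx, hy, smul_add]
  | @homogeneous w x =>
    have h1 := hsmul a b p hp w x x.2
    by_cases h : w = (v.1 - a, v.2 - b)
    · have h2 : (w.1 + (a : ℤ), w.2 + (b : ℤ)) = v := by rw [h]; simp
      rw [h2] at h1
      rw [cmp_same ℳ h1, ← h, cmp_same ℳ x.2]
    · rw [cmp_ne ℳ x.2 h, smul_zero, cmp_ne ℳ h1]
      intro h'
      apply h
      rw [← h']; simp

lemma cmp_PM (hsmul : SmulGr K m n ℳ) (v : ℤ × ℤ) (z : M)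
    (hz : z ∈ (Ideal.span (Set.range (X :
                Fin n → MvPolynomial (Fin n) (MvPolynomial (Fin m) K)))) •
              (⊤ : Submodule (MvPolynomial (Fin n) (MvPolynomial (Fin m) K)) M))
    (G : Submodule (MvPolynomial (Fin n) (MvPolynomial (Fin m) K)) M)
    (hG : ∀ i : Fin n, ∀ x ∈ ℳ (v.1, v.2 - 1),
      (X i : MvPolynomial (Fin n) (MvPolynomial (Fin m) K)) • x ∈ G) :
    cmp ℳ v z ∈ G := by
  refine Submodule.smul_induction_on hz ?_ ?_
  · intro p hp x _
    clear hz z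
    induction hp using Submodule.span_induction generalizing x with
    | mem p hp =>
      obtain ⟨i, rfl⟩ := hp
      rw [cmp_smul ℳ hsmul (isBihom_X i)]
      apply hG
      simpa using cmp_mem ℳ (v.1 - (0 : ℕ), v.2 - (1 : ℕ)) x
    | zero => simp
    | add p q _ _ h1 h2 => 
      rw [add_smul, map_add]
      exact add_mem (h1 x trivial) (h2 x trivial)
    | smul a p _ h =>
      have := h (a • x) trivial
      rwa [smul_smul, mul_comm, ← smul_eq_mul] at this
  · intro x y hx hy
    rw [map_add]; exact add_mem hx hy

/-- Homogeneous elements of the free module. -/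
def FHom {σ : Type} (D : σ → ℤ × ℤ)
    (u : σ →₀ MvPolynomial (Fin n) (MvPolynomial (Fin m) K)) (v : ℤ × ℤ) : Prop :=
  ∀ s β ν, coeff ν (coeff β (u s)) ≠ 0 →
    (tdeg ν : ℤ) = v.1 - (D s).1 ∧ (tdeg β : ℤ) = v.2 - (D s).2


lemma FHom.add {σ : Type} {D : σ → ℤ × ℤ}
    {u u' : σ →₀ MvPolynomial (Fin n) (MvPolynomial (Fin m) K)} {v : ℤ × ℤ}
    (h : FHom D u v) (h' : FHom D u' v) : FHom D (u + u') v := by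
  intro s β ν hne
  rw [Finsupp.add_apply, coeff_add, coeff_add] at hne
  by_cases h1 : coeff ν (coeff β (u s)) = 0
  · rw [h1, zero_add] at hne
    exact h' s β ν hne
  · exact h s β ν h1

lemma FHom.zero {σ : Type} {D : σ → ℤ × ℤ} {v : ℤ × ℤ} :
    FHom D (0 : σ →₀ MvPolynomial (Fin n) (MvPolynomial (Fin m) K)) v := by
  intro s β ν hne
  simp at hne

lemma eps_eq {σ : Type}
    (ε : (σ →₀ MvPolynomial (Fin n) (MvPolynomial (Fin m) K))
      →ₗ[MvPolynomial (Fin n) (MvPolynomial (Fin m) K)] M)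
    (u : σ →₀ MvPolynomial (Fin n) (MvPolynomial (Fin m) K)) :
    ε u = ∑ s ∈ u.support, u s • ε (Finsupp.single s 1) := by
  conv_lhs => rw [← Finsupp.sum_single u, Finsupp.sum, map_sum]
  refine Finset.sum_congr rfl fun s _ => ?_
  rw [← map_smul, Finsupp.smul_single, smul_eq_mul, mul_one]

lemma eps_mem (hsmul : SmulGr K m n ℳ) {σ : Type} (D : σ → ℤ × ℤ)
    (ε : (σ →₀ MvPolynomial (Fin n) (MvPolynomial (Fin m) K))
      →ₗ[MvPolynomial (Fin n) (MvPolynomial (Fin m) K)] M)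
    (hεgr : ∀ s, ε (Finsupp.single s 1) ∈ ℳ (D s))
    (u : σ →₀ MvPolynomial (Fin n) (MvPolynomial (Fin m) K)) (v : ℤ × ℤ) (hu : FHom D u v) :
    ε u ∈ ℳ v := by
  rw [eps_eq]
  refine Submodule.sum_mem _ fun s hs => ?_
  rw [Finsupp.mem_support_iff] at hs
  obtain ⟨β, hβ⟩ := MvPolynomial.exists_coeff_ne_zero hs
  obtain ⟨ν, hν⟩ := MvPolynomial.exists_coeff_ne_zero hβ
  have h1 := hu s β ν hν
  have h2 : IsBihom K m n (u s) (tdeg ν) (tdeg β) := by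
    intro β' ν' h'
    have := hu s β' ν' h'
    omega
  have h3 := hsmul _ _ _ h2 _ _ (hεgr s)
  rw [h1.1, h1.2] at h3
  simpa using h3

lemma FHom_single {σ : Type} (D : σ → ℤ × ℤ) (s : σ) (β : Fin n →₀ ℕ) (ν : Fin m →₀ ℕ) (a : K) :
    FHom D (Finsupp.single s (monomial β (monomial ν a)))
      ((D s).1 + tdeg ν, (D s).2 + tdeg β) := by
  classical
  intro s' β' ν' h
  rw [Finsupp.single_apply] at h
  split_ifs at h with h1
  · subst h1
    rw [coeff_monomial] at h
    split_ifs at h with h2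
    · subst h2
      rw [coeff_monomial] at h
      split_ifs at h with h3
      · subst h3; simp
      · simp at h
    · simp at h
  · simp at h

lemma exists_hom (hsmul : SmulGr K m n ℳ) {σ : Type} (D : σ → ℤ × ℤ)
    (ε : (σ →₀ MvPolynomial (Fin n) (MvPolynomial (Fin m) K))
      →ₗ[MvPolynomial (Fin n) (MvPolynomial (Fin m) K)] M)
    (hεgr : ∀ s, ε (Finsupp.single s 1) ∈ ℳ (D s))
    (u : σ →₀ MvPolynomial (Fin n) (MvPolynomial (Fin m) K)) (v : ℤ × ℤ) :
    ∃ u', FHom D u' v ∧ ε u' = cmp ℳ v (ε u) := by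
  have hadd : ∀ u₁ u₂ : σ →₀ MvPolynomial (Fin n) (MvPolynomial (Fin m) K),
      (∃ u', FHom D u' v ∧ ε u' = cmp ℳ v (ε u₁)) → (∃ u', FHom D u' v ∧ ε u' = cmp ℳ v (ε u₂)) →
      (∃ u', FHom D u' v ∧ ε u' = cmp ℳ v (ε (u₁ + u₂))) := by
    rintro u₁ u₂ ⟨a, ha, ha'⟩ ⟨b, hb, hb'⟩
    exact ⟨a + b, ha.add hb, by rw [map_add, map_add, map_add, ha', hb']⟩
  induction u using Finsupp.induction_linear with
  | zero => exact ⟨0, FHom.zero, by simp⟩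
  | add f g hf hg => exact hadd f g hf hg
  | single s p =>
    induction p using MvPolynomial.induction_on' with
    | monomial β p =>
      induction p using MvPolynomial.induction_on' with
      | monomial ν a =>
        have h1 := FHom_single D s β ν a
        have h2 := eps_mem ℳ hsmul D ε hεgr _ _ h1
        by_cases hv : ((D s).1 + (tdeg ν : ℤ), (D s).2 + (tdeg β : ℤ)) = v
        · subst hv
          exact ⟨_, h1, (cmp_same ℳ h2).symm⟩
        · exact ⟨0, FHom.zero, by rw [cmp_ne ℳ h2 hv, map_zero]⟩
      | add p q hp hq =>
        rw [map_add, Finsupp.single_add]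
        exact hadd _ _ hp hq
    | add p q hp hq =>
      rw [Finsupp.single_add]
      exact hadd _ _ hp hq

lemma exists_hom_of_mem (hsmul : SmulGr K m n ℳ) {σ : Type} (D : σ → ℤ × ℤ)
    (ε : (σ →₀ MvPolynomial (Fin n) (MvPolynomial (Fin m) K))
      →ₗ[MvPolynomial (Fin n) (MvPolynomial (Fin m) K)] M)
    (hsurj : Function.Surjective ε)
    (hεgr : ∀ s, ε (Finsupp.single s 1) ∈ ℳ (D s))
    (v : ℤ × ℤ) (x : M) (hx : x ∈ ℳ v) :
    ∃ u, FHom D u v ∧ ε u = x := by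
  obtain ⟨u, rfl⟩ := hsurj x
  obtain ⟨u', h1, h2⟩ := exists_hom ℳ hsmul D ε hεgr u v
  exact ⟨u', h1, by rw [h2, cmp_same ℳ hx]⟩

lemma annih_hom [Module (MvPolynomial (Fin m) K) M]
    [IsScalarTower (MvPolynomial (Fin m) K)
      (MvPolynomial (Fin n) (MvPolynomial (Fin m) K)) M]
    (hsmul : SmulGr K m n ℳ)
    (Q : Submodule (MvPolynomial (Fin n) (MvPolynomial (Fin m) K)) M)
    (hQ : ∀ v, ∀ x ∈ Q, cmp ℳ v x ∈ Q) :
    (Module.annihilator (MvPolynomial (Fin m) K)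
      (M ⧸ Submodule.restrictScalars (MvPolynomial (Fin m) K) Q)).IsHomogeneous
        (homogeneousSubmodule (Fin m) K) := by
  have hann : ∀ p, p ∈ Module.annihilator (MvPolynomial (Fin m) K)
      (M ⧸ Submodule.restrictScalars (MvPolynomial (Fin m) K) Q) ↔
      ∀ x : M, (C p : MvPolynomial (Fin n) (MvPolynomial (Fin m) K)) • x ∈ Q := by
    intro p
    rw [Module.mem_annihilator]
    constructor
    · intro h x
      have := h (Submodule.Quotient.mk x)
      rw [← Submodule.Quotient.mk_smul, Submodule.Quotient.mk_eq_zero] at this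
      rw [← algebraMap_eq, algebraMap_smul]
      exact this
    · intro h x
      obtain ⟨x, rfl⟩ := Submodule.Quotient.mk_surjective _ x
      rw [← Submodule.Quotient.mk_smul, Submodule.Quotient.mk_eq_zero]
      have := h x
      rw [← algebraMap_eq, algebraMap_smul] at this
      exact this
  intro a p hp
  have hdc : (DirectSum.decompose (homogeneousSubmodule (Fin m) K) p a : MvPolynomial (Fin m) K)
    = homogeneousComponent a p := decomposition.decompose'_apply p a
  rw [hdc, hann]
  rw [hann] at hp
  intro x
  induction x using DirectSum.Decomposition.inductionOn ℳ with
  | zero => simp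
  | add x y hx hy => rw [smul_add]; exact add_mem hx hy
  | @homogeneous v x =>
    have h1 := hQ (v.1 + (a : ℤ), v.2) _ (hp x)
    convert h1 using 1
    conv_rhs => rw [← sum_homogeneousComponent p]
    rw [map_sum, Finset.sum_smul, map_sum]
    have hmem : ∀ i : ℕ, (C (homogeneousComponent i p) :
        MvPolynomial (Fin n) (MvPolynomial (Fin m) K)) • (x : M) ∈ ℳ (v.1 + (i : ℤ), v.2) := by
      intro i
      simpa using hsmul _ _ _ (isBihom_C _ i (homogeneousComponent_isHomogeneous i p)) v x x.2
    by_cases hlt : a < p.totalDegree + 1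
    · rw [Finset.sum_eq_single a]
      · rw [cmp_same ℳ (hmem a)]
      · intro i _ hne
        refine cmp_ne ℳ (hmem i) ?_
        intro h
        rw [Prod.mk.injEq] at h
        omega
      · intro h; exact absurd (Finset.mem_range.2 hlt) h
    · rw [homogeneousComponent_eq_zero a p (by omega), map_zero, zero_smul, Finset.sum_eq_zero]
      intro i hi
      refine cmp_ne ℳ (hmem i) ?_
      intro h
      rw [Prod.mk.injEq] at h
      rw [Finset.mem_range] at hi
      omega

lemma main_M [Module (MvPolynomial (Fin m) K) M]
    [IsScalarTower (MvPolynomial (Fin m) K)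
      (MvPolynomial (Fin n) (MvPolynomial (Fin m) K)) M]
    [Module.Finite (MvPolynomial (Fin n) (MvPolynomial (Fin m) K)) M]
    (hsmul : SmulGr K m n ℳ) {σ : Type} [Fintype σ] (D : σ → ℤ × ℤ)
    (ε : (σ →₀ MvPolynomial (Fin n) (MvPolynomial (Fin m) K))
      →ₗ[MvPolynomial (Fin n) (MvPolynomial (Fin m) K)] M)
    (hsurj : Function.Surjective ε)
    (hεgr : ∀ s, ε (Finsupp.single s 1) ∈ ℳ (D s))
    (hdim : ringKrullDim ((MvPolynomial (Fin m) K) ⧸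
        Module.annihilator (MvPolynomial (Fin m) K)
          (M ⧸ Submodule.restrictScalars (MvPolynomial (Fin m) K)
            ((Ideal.span (Set.range (MvPolynomial.X :
                Fin n → MvPolynomial (Fin n) (MvPolynomial (Fin m) K)))) •
              (⊤ : Submodule (MvPolynomial (Fin n) (MvPolynomial (Fin m) K)) M)))) ≤ 1) :
    ∃ (g : MvPolynomial (Fin m) K) (r : ℕ) (d1 : ℤ),
      g.IsHomogeneous r ∧ g ∈ idealOfVars (Fin m) K ∧
      (∀ d b : ℤ, d1 ≤ d → ∀ x ∈ ℳ (d, b), ∃ x' ∈ ℳ (d - r, b),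
        (C g : MvPolynomial (Fin n) (MvPolynomial (Fin m) K)) • x' = x) ∧
      (∀ d b : ℤ, d1 ≤ d → ∀ x ∈ ℳ (d, b),
        (C g : MvPolynomial (Fin n) (MvPolynomial (Fin m) K)) • x = 0 → x = 0) := by
  set PM := (Ideal.span (Set.range (MvPolynomial.X :
                Fin n → MvPolynomial (Fin n) (MvPolynomial (Fin m) K)))) •
              (⊤ : Submodule (MvPolynomial (Fin n) (MvPolynomial (Fin m) K)) M) with hPM
  have hXPM : ∀ (i : Fin n) (x : M),
      (X i : MvPolynomial (Fin n) (MvPolynomial (Fin m) K)) • x ∈ PM := fun i x =>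
    Submodule.smul_mem_smul (Ideal.subset_span ⟨i, rfl⟩) trivial
  have hcl : ∀ v, ∀ x ∈ PM, cmp ℳ v x ∈ PM := fun v x hx =>
    cmp_PM ℳ hsmul v x hx PM (fun i x _ => hXPM i x)
  obtain ⟨g, r, t, hr, hghom, hgm, ht⟩ := exists_param _ (annih_hom ℳ hsmul PM hcl) hdim
  have hgb := isBihom_C (n := n) g r hghom
  set G := LinearMap.range (LinearMap.lsmul (MvPolynomial (Fin n) (MvPolynomial (Fin m) K)) M (C g))
    with hG
  obtain ⟨A, hA⟩ := (Set.finite_range (fun s => (D s).1)).bddAbove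
  obtain ⟨B, hB⟩ := (Set.finite_range (fun s => (D s).2)).bddBelow
  replace hA : ∀ s, (D s).1 ≤ A := fun s => hA ⟨s, rfl⟩
  replace hB : ∀ s, B ≤ (D s).2 := fun s => hB ⟨s, rfl⟩
  -- first: elements of large x-degree lie in PM + gM
  have step1 : ∀ d b : ℤ, A + t ≤ d → ∀ x ∈ ℳ (d, b), x ∈ PM ⊔ G := by
    intro d b hd x hx
    obtain ⟨u, hu, rfl⟩ := exists_hom_of_mem ℳ hsmul D ε hsurj hεgr _ x hx
    rw [eps_eq]
    refine Submodule.sum_mem _ fun s _ => ?_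
    rw [(u s).as_sum, Finset.sum_smul]
    refine Submodule.sum_mem _ fun β _ => ?_
    rw [← mul_one (coeff β (u s)), ← C_mul_monomial, mul_comm, mul_smul]
    refine Submodule.smul_mem _ _ ?_
    generalize ε (Finsupp.single s 1) = z
    have hmem : coeff β (u s) ∈ idealOfVars (Fin m) K ^ t := by
      rw [mem_pow_idealOfVars_iff']
      intro ν hν
      by_contra hne
      have h1 := (hu s β ν hne).1
      have h2 := hA s
      rw [tdeg_eq_degree] at h1
      simp only at h1
      omega
    obtain ⟨p, hp, q, hq, hpq⟩ := Submodule.mem_sup.1 (ht hmem)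
    rw [← hpq, map_add, add_smul]
    refine Submodule.add_mem_sup ?_ ?_
    · rw [Module.mem_annihilator] at hp
      have := hp (Submodule.Quotient.mk z)
      rw [← Submodule.Quotient.mk_smul, Submodule.Quotient.mk_eq_zero] at this
      rw [← algebraMap_eq, algebraMap_smul]
      exact this
    · obtain ⟨q, rfl⟩ := Ideal.mem_span_singleton'.1 hq
      refine ⟨(C q : MvPolynomial (Fin n) (MvPolynomial (Fin m) K)) • z, ?_⟩
      rw [LinearMap.lsmul_apply, smul_smul, ← map_mul, mul_comm]
  have step2 : ∀ (k : ℕ) (d b : ℤ), A + t ≤ d → b < B + k → ∀ x ∈ ℳ (d, b), x ∈ G := by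
    intro k
    induction k with
    | zero =>
      intro d b hd hb x hx
      obtain ⟨u, hu, rfl⟩ := exists_hom_of_mem ℳ hsmul D ε hsurj hεgr _ x hx
      have : u = 0 := by
        ext s β ν
        by_contra hne
        have h1 := (hu s β ν (by simpa using hne)).2
        have h2 := hB s
        simp only at h1
        omega
      rw [this, map_zero]; exact zero_mem _
    | succ k ih =>
      intro d b hd hb x hx
      obtain ⟨z, hz, y, ⟨y, rfl⟩, hzy⟩ := Submodule.mem_sup.1 (step1 d b hd x hx)
      rw [← cmp_same ℳ hx, ← hzy, map_add]
      refine add_mem ?_ ?_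
      · refine cmp_PM ℳ hsmul _ z hz G fun i x hx => Submodule.smul_mem _ _ ?_
        exact ih d (b - 1) hd (by push_cast at hb; omega) x hx
      · rw [LinearMap.lsmul_apply, cmp_smul ℳ hsmul hgb]
        exact ⟨_, rfl⟩
  have step3 : ∀ d b : ℤ, A + t ≤ d → ∀ x ∈ ℳ (d, b), ∃ x' ∈ ℳ (d - r, b),
        (C g : MvPolynomial (Fin n) (MvPolynomial (Fin m) K)) • x' = x := by
    intro d b hd x hx
    obtain ⟨y, hy⟩ := step2 ((b - B).toNat + 1) d b hd (by omega) x hx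
    refine ⟨cmp ℳ (d - r, b) y, cmp_mem _ _ _, ?_⟩
    have := cmp_smul ℳ hsmul hgb (d, b) y
    rw [← LinearMap.lsmul_apply, hy, cmp_same ℳ hx] at this
    rw [this]; simp
  have step4 : ∀ (k : ℕ) (d b : ℤ), A + t + k * r ≤ d → ∀ x ∈ ℳ (d, b),
      ∃ x', (LinearMap.lsmul (MvPolynomial (Fin n) (MvPolynomial (Fin m) K)) M (C g) ^ k :
        Module.End _ _) x' = x := by
    intro k
    induction k with
    | zero => intro d b _ x _; exact ⟨x, rfl⟩
    | succ k ih =>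
      intro d b hd x hx
      push_cast at hd
      have hkr : (0 : ℤ) ≤ k * r := by positivity
      obtain ⟨x', hx', rfl⟩ := step3 d b (by nlinarith) x hx
      obtain ⟨y, rfl⟩ := ih (d - r) b (by linarith) x' hx'
      refine ⟨y, ?_⟩
      rw [pow_succ', Module.End.mul_apply]; rfl
  haveI : IsNoetherian (MvPolynomial (Fin n) (MvPolynomial (Fin m) K)) M := inferInstance
  obtain ⟨k0, hk0⟩ := Filter.eventually_atTop.1 (Module.End.eventually_disjoint_ker_pow_range_pow
    (LinearMap.lsmul (MvPolynomial (Fin n) (MvPolynomial (Fin m) K)) M (C g)))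
  have hdis := hk0 (k0 + 1) (by omega)
  refine ⟨g, r, A + t + (k0 + 1 : ℕ) * r, hghom, hgm, ?_, ?_⟩
  · intro d b hd
    have hkr : (0 : ℤ) ≤ (k0 + 1 : ℕ) * r := by positivity
    exact step3 d b (by linarith)
  · intro d b hd x hx hgx
    obtain ⟨y, hy⟩ := step4 (k0 + 1) d b hd x hx
    refine Submodule.disjoint_def.1 hdis x ?_ ⟨y, hy⟩
    rw [LinearMap.mem_ker, pow_succ, Module.End.mul_apply, LinearMap.lsmul_apply, hgx, map_zero]

end ModPart

section PsiPart

variable {A : Type} [CommRing A] {n : ℕ} {σ σ' : Type}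

open scoped Classical in
/-- The map from a free module to its top local cohomology, given by multiplying
the class `z^κ` with the polynomial coordinates. -/
noncomputable def Psi (κ : Fin n →₀ ℕ) :
    (σ →₀ MvPolynomial (Fin n) A) →ₗ[A] Emod A n σ where
  toFun u := Finsupp.onFinset (u.support ×ˢ Finset.Icc 0 κ)
    (fun p => if p.2 ≤ κ then coeff (κ - p.2) (u p.1) else 0) (by
      rintro ⟨s, c⟩ h
      simp only [ne_eq, ite_eq_right_iff, Classical.not_imp] at h
      simp only [Finset.mem_product, Finsupp.mem_support_iff, Finset.mem_Icc, zero_le, true_and]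
      refine ⟨fun h0 => h.2 (by rw [h0]; simp), h.1⟩)
  map_add' u v := by
    ext ⟨s, c⟩
    simp only [Finsupp.onFinset_apply, Finsupp.add_apply, coeff_add]
    split_ifs <;> simp
  map_smul' a v := by
    ext ⟨s, c⟩
    simp only [Finsupp.onFinset_apply, Finsupp.smul_apply, coeff_smul, RingHom.id_apply]
    split_ifs <;> simp

open scoped Classical in
lemma Psi_apply (κ : Fin n →₀ ℕ) (u : σ →₀ MvPolynomial (Fin n) A) (s : σ) (c : Fin n →₀ ℕ) :
    Psi κ u (s, c) = if c ≤ κ then coeff (κ - c) (u s) else 0 := rfl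

open scoped Classical in
lemma contract_single (f : MvPolynomial (Fin n) A) (e c : Fin n →₀ ℕ) :
    contract A n f (Finsupp.single e 1) c = if c ≤ e then coeff (e - c) f else 0 := by
  unfold contract
  rw [Finsupp.lsum_single, LinearMap.smulRight_apply, LinearMap.id_apply, one_smul,
    Finsupp.finsetSum_apply]
  have : ∀ β ∈ f.support, ((if β ≤ e then Finsupp.single (e - β) (coeff β f) else 0 :
      (Fin n →₀ ℕ) →₀ A) c) = if c ≤ e ∧ β = e - c then coeff β f else 0 := by
    intro β _
    by_cases hβ : β ≤ e
    · rw [if_pos hβ, Finsupp.single_apply]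
      congr 1
      refine propext ⟨?_, ?_⟩
      · rintro rfl
        exact ⟨tsub_le_self, (tsub_tsub_cancel_of_le hβ).symm⟩
      · rintro ⟨h, rfl⟩
        exact tsub_tsub_cancel_of_le h
    · rw [if_neg hβ, if_neg]
      · rfl
      · rintro ⟨_, rfl⟩
        exact hβ tsub_le_self
  rw [Finset.sum_congr rfl this]
  by_cases hc : c ≤ e
  · simp only [hc, true_and, if_true]
    rw [Finset.sum_ite_eq']
    split_ifs with h
    · rfl
    · exact (notMem_support_iff.mp h).symm
  · simp [hc]

open scoped Classical in
lemma emap_single_apply (φ : (σ' →₀ MvPolynomial (Fin n) A) →ₗ[MvPolynomial (Fin n) A]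
      (σ →₀ MvPolynomial (Fin n) A)) (s' : σ') (e : Fin n →₀ ℕ) (a : A) (s : σ)
      (c : Fin n →₀ ℕ) :
    emap A n φ (Finsupp.single (s', e) a) (s, c) =
      a * (if c ≤ e then coeff (e - c) (φ (Finsupp.single s' 1) s) else 0) := by
  unfold emap
  rw [Finsupp.lsum_single, LinearMap.smulRight_apply, LinearMap.id_apply, Finsupp.smul_apply,
    smul_eq_mul, Finsupp.finsetSum_apply]
  congr 1
  set F := φ (Finsupp.single s' 1)
  have : ∀ t ∈ F.support, (Finsupp.mapDomain (fun c => (t, c))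
      (contract A n (F t) (Finsupp.single e 1))) (s, c) =
      if t = s then (if c ≤ e then coeff (e - c) (F s) else 0) else 0 := by
    intro t _
    by_cases h : t = s
    · subst h
      rw [if_pos rfl, ← contract_single]
      exact Finsupp.mapDomain_apply (f := fun c : Fin n →₀ ℕ => (t, c))
        (fun x y h => (Prod.mk.inj h).2) _ c
    · rw [if_neg h]
      apply Finsupp.mapDomain_of_notMem_range
      rintro ⟨x, hx⟩
      exact h (Prod.mk.inj hx).1
  rw [Finset.sum_congr rfl this, Finset.sum_ite_eq']
  split_ifs with h1 h2
  · rfl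
  · rfl
  · rw [Finsupp.notMem_support_iff.mp h1]; simp
  · rfl

lemma Psi_single (κ : Fin n →₀ ℕ) (s : σ) (β : Fin n →₀ ℕ) (a : A) (h : β ≤ κ) :
    Psi κ (Finsupp.single s (monomial β a)) = Finsupp.single (s, κ - β) a := by
  classical
  ext ⟨t, c⟩
  rw [Psi_apply, Finsupp.single_apply, Finsupp.single_apply]
  by_cases ht : s = t
  · subst ht
    rw [if_pos rfl, coeff_monomial, ← ite_and]
    congr 1
    simp only [Prod.mk.injEq, true_and]
    refine propext ⟨?_, ?_⟩
    · rintro ⟨h', rfl⟩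
      exact tsub_tsub_cancel_of_le h'
    · rintro rfl
      exact ⟨tsub_le_self, (tsub_tsub_cancel_of_le h).symm⟩
  · rw [if_neg ht, if_neg (fun h => ht (Prod.mk.inj h).1)]
    simp

lemma Psi_single_not (κ : Fin n →₀ ℕ) (u : σ →₀ MvPolynomial (Fin n) A) (β : Fin n →₀ ℕ) (a : A)
    (h : ¬ β ≤ κ) : Psi κ (monomial β a • u) = 0 := by
  classical
  ext ⟨t, c⟩
  rw [Psi_apply, Finsupp.smul_apply, smul_eq_mul, coeff_monomial_mul']
  split_ifs with h1 h2
  · exact absurd (h2.trans tsub_le_self) h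
  · rfl
  · rfl

lemma emap_Psi (φ : (σ' →₀ MvPolynomial (Fin n) A) →ₗ[MvPolynomial (Fin n) A]
      (σ →₀ MvPolynomial (Fin n) A)) (κ : Fin n →₀ ℕ) (v : σ' →₀ MvPolynomial (Fin n) A) :
    emap A n φ (Psi κ v) = Psi κ (φ v) := by
  classical
  induction v using Finsupp.induction_linear with
  | zero => simp
  | add f g hf hg => rw [map_add, map_add, hf, hg, map_add, map_add]
  | single s' p =>
    induction p using MvPolynomial.induction_on' with
    | add f g hf hg =>
      rw [Finsupp.single_add, map_add, map_add, hf, hg, map_add, map_add]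
    | monomial β a =>
      have h1 : Finsupp.single s' (monomial β a) =
          (monomial β a : MvPolynomial (Fin n) A) • Finsupp.single s' 1 := by
        rw [Finsupp.smul_single, smul_eq_mul, mul_one]
      by_cases h : β ≤ κ
      · rw [Psi_single κ s' β a h, h1, map_smul]
        ext ⟨s, c⟩
        rw [emap_single_apply, Psi_apply, Finsupp.smul_apply, smul_eq_mul, coeff_monomial_mul']
        have : (c ≤ κ - β) ↔ (c ≤ κ ∧ β ≤ κ - c) := by
          constructor
          · intro h'
            exact ⟨h'.trans tsub_le_self, le_tsub_of_add_le_left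
              ((add_le_of_le_tsub_right_of_le h h'))⟩
          · rintro ⟨h1, h2⟩
            exact le_tsub_of_add_le_left (add_le_of_le_tsub_right_of_le h1 h2)
        by_cases hc : c ≤ κ - β
        · have := this.mp hc
          rw [if_pos hc, if_pos this.1, if_pos this.2, tsub_right_comm]
        · rw [if_neg hc, mul_zero]
          by_cases h3 : c ≤ κ
          · rw [if_pos h3, if_neg (fun h4 => hc (this.mpr ⟨h3, h4⟩))]
          · rw [if_neg h3]
      · rw [h1, Psi_single_not κ _ β a h, map_smul, Psi_single_not κ _ β a h, map_zero]

open scoped Classical in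
/-- A section of `Psi κ` on elements supported below `κ`. -/
noncomputable def usec [Fintype σ] (κ : Fin n →₀ ℕ) (w : Emod A n σ) :
    σ →₀ MvPolynomial (Fin n) A :=
  Finsupp.equivFunOnFinite.symm fun s =>
    ∑ c ∈ Finset.Icc 0 κ, monomial (κ - c) (w (s, c))

open scoped Classical in
lemma coeff_usec [Fintype σ] (κ : Fin n →₀ ℕ) (w : Emod A n σ) (s : σ) (γ : Fin n →₀ ℕ) :
    coeff γ (usec κ w s) = if γ ≤ κ then w (s, κ - γ) else 0 := by
  unfold usec
  rw [Finsupp.equivFunOnFinite_symm_apply_apply, coeff_sum]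
  have : ∀ c ∈ Finset.Icc 0 κ, coeff γ (monomial (κ - c) (w (s, c))) =
      if c = κ - γ then (if γ ≤ κ then w (s, κ - γ) else 0) else 0 := by
    intro c hc
    have hc := (Finset.mem_Icc.mp hc).2
    rw [coeff_monomial]
    by_cases h : κ - c = γ
    · subst h
      rw [if_pos rfl, tsub_tsub_cancel_of_le hc, if_pos rfl, if_pos tsub_le_self]
    · rw [if_neg h]
      by_cases h2 : c = κ - γ
      · rw [if_pos h2, if_neg]
        intro h3
        subst h2
        exact h (tsub_tsub_cancel_of_le h3)
      · rw [if_neg h2]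
  rw [Finset.sum_congr rfl this, Finset.sum_ite_eq', if_pos]
  simp

lemma Psi_usec [Fintype σ] (κ : Fin n →₀ ℕ) (w : Emod A n σ)
    (hw : ∀ s c, w (s, c) ≠ 0 → c ≤ κ) : Psi κ (usec κ w) = w := by
  classical
  ext ⟨s, c⟩
  rw [Psi_apply]
  by_cases h : c ≤ κ
  · rw [if_pos h, coeff_usec, if_pos tsub_le_self, tsub_tsub_cancel_of_le h]
  · rw [if_neg h]
    by_contra h'
    exact h (hw s c (Ne.symm h'))

lemma exists_kappa (w : Emod A n σ) : ∃ κ : Fin n →₀ ℕ, ∀ s c, w (s, c) ≠ 0 → c ≤ κ := by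
  classical
  refine ⟨∑ p ∈ w.support, p.2, fun s c h => ?_⟩
  exact Finset.single_le_sum (f := fun p : σ × (Fin n →₀ ℕ) => p.2) (fun _ _ => zero_le)
    (Finsupp.mem_support_iff.mpr h)

end PsiPart

section PsiMod

variable {K : Type} [Field K] {m n : ℕ} {σ : Type}

lemma tdeg_tsub {n : ℕ} {c κ : Fin n →₀ ℕ} (h : c ≤ κ) :
    (tdeg (κ - c) : ℤ) = tdeg κ - tdeg c := by
  have : tdeg (κ - c) + tdeg c = tdeg κ := by
    rw [tdeg_eq_degree, tdeg_eq_degree, tdeg_eq_degree, ← map_add, tsub_add_cancel_of_le h]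
  omega

lemma usec_FHom [Fintype σ] (D : σ → ℤ × ℤ) (κ : Fin n →₀ ℕ)
    (w : Emod (MvPolynomial (Fin m) K) n σ) (d j : ℤ)
    (hy : w ∈ ystrand (MvPolynomial (Fin m) K) n (fun s => (D s).2) j)
    (hx : w ∈ xstrandE K m n (fun s => (D s).1) d) :
    FHom D (usec κ w) (d, j + n + tdeg κ) := by
  classical
  intro s β ν h
  rw [coeff_usec] at h
  split_ifs at h with hβ
  · have h1 := hx s _ ν h
    have h2 := hy s (κ - β) (fun h0 => h (by rw [h0]; simp))
    rw [tdeg_tsub hβ] at h2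
    refine ⟨h1, ?_⟩
    simp only
    linarith
  · simp at h

lemma Psi_strand (D : σ → ℤ × ℤ) (κ : Fin n →₀ ℕ)
    (u : σ →₀ MvPolynomial (Fin n) (MvPolynomial (Fin m) K)) (d j : ℤ)
    (hu : FHom D u (d, j + n + tdeg κ)) :
    Psi κ u ∈ ystrand (MvPolynomial (Fin m) K) n (fun s => (D s).2) j ∧
    Psi κ u ∈ xstrandE K m n (fun s => (D s).1) d := by
  classical
  have key : ∀ s c ν, coeff ν (Psi κ u (s, c)) ≠ 0 →
      (tdeg c : ℤ) = (D s).2 - n - j ∧ (tdeg ν : ℤ) = d - (D s).1 := by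
    intro s c ν h
    rw [Psi_apply] at h
    split_ifs at h with hc
    · have := hu s _ ν h
      rw [tdeg_tsub hc] at this
      refine ⟨?_, this.1⟩
      have := this.2
      simp only at this
      linarith
    · simp at h
  refine ⟨?_, fun s c ν h => (key s c ν h).2⟩
  intro s c h
  obtain ⟨ν, hν⟩ := MvPolynomial.ne_zero_iff.mp h
  exact (key s c ν hν).1

variable {M : Type} [AddCommGroup M]
    [Module K M]
    [Module (MvPolynomial (Fin n) (MvPolynomial (Fin m) K)) M]

/-- The additive subgroup `J_κ M`, where `J_κ` is generated by the monomials not dividing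
`y^κ`. -/
def JM (K : Type) [Field K] (m : ℕ) {n : ℕ} (M : Type) [AddCommGroup M]
    [Module (MvPolynomial (Fin n) (MvPolynomial (Fin m) K)) M] (κ : Fin n →₀ ℕ) :
    AddSubmonoid M :=
  AddSubmonoid.closure {z | ∃ (β : Fin n →₀ ℕ) (x : M), ¬ β ≤ κ ∧
    z = (monomial β 1 : MvPolynomial (Fin n) (MvPolynomial (Fin m) K)) • x}

lemma JM_i (ε : (σ →₀ MvPolynomial (Fin n) (MvPolynomial (Fin m) K))
      →ₗ[MvPolynomial (Fin n) (MvPolynomial (Fin m) K)] M) (κ : Fin n →₀ ℕ)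
    (u : σ →₀ MvPolynomial (Fin n) (MvPolynomial (Fin m) K)) (hu : Psi κ u = 0) :
    ε u ∈ JM K m M κ := by
  classical
  rw [eps_eq]
  refine sum_mem fun s _ => ?_
  have key : ∀ β ∈ (u s).support, ¬ β ≤ κ := by
    intro β hβ h
    have := DFunLike.congr_fun hu (s, κ - β)
    rw [Psi_apply, if_pos tsub_le_self, tsub_tsub_cancel_of_le h] at this
    exact mem_support_iff.mp hβ this
  rw [(u s).as_sum, Finset.sum_smul]
  refine sum_mem fun β hβ => AddSubmonoid.subset_closure ⟨β,
    (C (coeff β (u s)) : MvPolynomial (Fin n) (MvPolynomial (Fin m) K)) •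
      ε (Finsupp.single s 1), key β hβ, ?_⟩
  rw [smul_smul, mul_comm, C_mul_monomial, mul_one]

lemma JM_ii (ε : (σ →₀ MvPolynomial (Fin n) (MvPolynomial (Fin m) K))
      →ₗ[MvPolynomial (Fin n) (MvPolynomial (Fin m) K)] M) (hsurj : Function.Surjective ε)
    (κ : Fin n →₀ ℕ) (z : M) (hz : z ∈ JM K m M κ) :
    ∃ v, ε v = z ∧ Psi κ v = 0 := by
  induction hz using AddSubmonoid.closure_induction with
  | mem z hz =>
    obtain ⟨β, x, hβ, rfl⟩ := hz
    obtain ⟨u, rfl⟩ := hsurj x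
    exact ⟨monomial β 1 • u, map_smul _ _ _, Psi_single_not κ u β 1 hβ⟩
  | zero => exact ⟨0, map_zero _, map_zero _⟩
  | add x y _ _ hx hy =>
    obtain ⟨v, rfl, hv⟩ := hx
    obtain ⟨v', rfl, hv'⟩ := hy
    exact ⟨v + v', map_add _ _ _, by rw [map_add, hv, hv', add_zero]⟩

lemma JM_iii (ℳ : ℤ × ℤ → Submodule K M) [DirectSum.Decomposition ℳ]
    (hsmul : SmulGr K m n ℳ) (g : MvPolynomial (Fin m) K) (r : ℕ) (d1 : ℤ)
    (hs : ∀ d b, d1 ≤ d → ∀ x ∈ ℳ (d, b), ∃ x' ∈ ℳ (d - r, b),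
      (C g : MvPolynomial (Fin n) (MvPolynomial (Fin m) K)) • x' = x)
    (κ : Fin n →₀ ℕ) (z : M) (hz : z ∈ JM K m M κ) (d b : ℤ) (hd : d1 ≤ d) :
    ∃ z' ∈ ℳ (d - r, b), z' ∈ JM K m M κ ∧
      cmp ℳ (d, b) z = (C g : MvPolynomial (Fin n) (MvPolynomial (Fin m) K)) • z' := by
  induction hz using AddSubmonoid.closure_induction with
  | mem z hz =>
    obtain ⟨β, x, hβ, rfl⟩ := hz
    rw [cmp_smul ℳ hsmul (isBihom_monomial β)]
    obtain ⟨x', hx', h⟩ := hs (d - (0 : ℕ)) (b - tdeg β) (by simpa using hd) _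
      (cmp_mem ℳ (d - (0 : ℕ), b - tdeg β) x)
    refine ⟨monomial β 1 • x', ?_, AddSubmonoid.subset_closure ⟨β, x', hβ, rfl⟩, ?_⟩
    · have := hsmul 0 (tdeg β) _ (isBihom_monomial β) _ _ hx'
      simpa using this
    · simp only
      rw [← h, smul_smul, smul_smul, mul_comm]
  | zero => exact ⟨0, zero_mem _, zero_mem _, by simp⟩
  | add x y _ _ hx hy =>
    obtain ⟨v, h1, h2, h3⟩ := hx
    obtain ⟨v', h1', h2', h3'⟩ := hy
    exact ⟨v + v', add_mem h1 h1', add_mem h2 h2', by rw [map_add, h3, h3', smul_add]⟩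

end PsiMod


/-- **Proposition (paper, Proposition 2.6).** Let `M` be a finitely generated bigraded
`P`-module with `dim_{P₀} M/P₊M ≤ 1`.  Then `j ↦ reg H^n_{P₊}(M)_j` is bounded above:
there is a constant `c` such that `reg H^n_{P₊}(M)_j ≤ c` for all `j ≪ 0`.  Here
`H^n_{P₊}(M)_j = H₀(H^n_{P₊}(F))_j` is computed from a bigraded free resolution `F` of `M`
(Theorem 1.1 of the paper) and `reg` is Castelnuovo–Mumford regularity over `P₀`. -/
theorem regularity_of_top_local_cohomology_bounded_above
    (K : Type) [Field K] (m n : ℕ)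
    (M : Type) [AddCommGroup M]
    [Module K M] [Module (MvPolynomial (Fin m) K) M]
    [Module (MvPolynomial (Fin n) (MvPolynomial (Fin m) K)) M]
    [IsScalarTower K (MvPolynomial (Fin m) K) M]
    [IsScalarTower (MvPolynomial (Fin m) K)
      (MvPolynomial (Fin n) (MvPolynomial (Fin m) K)) M]
    [Module.Finite (MvPolynomial (Fin n) (MvPolynomial (Fin m) K)) M]
    -- a bigrading of `M`, compatible with the bigrading of `P`:
    (ℳ : ℤ × ℤ → Submodule K M)
    (hdecomp : DirectSum.IsInternal ℳ)
    (hsmul : ∀ (a b : ℕ) (p : MvPolynomial (Fin n) (MvPolynomial (Fin m) K)),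
      IsBihom K m n p a b →
      ∀ (v : ℤ × ℤ) (x : M), x ∈ ℳ v → p • x ∈ ℳ (v.1 + a, v.2 + b))
    -- a bigraded free resolution `⋯ → F₁ → F₀ → M → 0` of `M`,
    -- with `Fᵢ = ⊕_{s : σ i} P(-(D i s).1, -(D i s).2)`:
    (σ : ℕ → Type) [∀ i, Fintype (σ i)]
    (D : ∀ i, σ i → ℤ × ℤ)
    (φ : ∀ i, ((σ (i + 1)) →₀ MvPolynomial (Fin n) (MvPolynomial (Fin m) K))
      →ₗ[MvPolynomial (Fin n) (MvPolynomial (Fin m) K)]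
      ((σ i) →₀ MvPolynomial (Fin n) (MvPolynomial (Fin m) K)))
    (ε : ((σ 0) →₀ MvPolynomial (Fin n) (MvPolynomial (Fin m) K))
      →ₗ[MvPolynomial (Fin n) (MvPolynomial (Fin m) K)] M)
    (hsurj : Function.Surjective ε)
    (hexact₀ : Function.Exact (φ 0) ε)
    (hexact : ∀ i, Function.Exact (φ (i + 1)) (φ i))
    (hφgr : ∀ i s' s β ν,
      MvPolynomial.coeff ν (MvPolynomial.coeff β ((φ i (Finsupp.single s' 1)) s)) ≠ 0 →
      (tdeg ν : ℤ) = (D (i + 1) s').1 - (D i s).1 ∧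
        (tdeg β : ℤ) = (D (i + 1) s').2 - (D i s).2)
    (hεgr : ∀ s, ε (Finsupp.single s 1) ∈ ℳ (D 0 s))
    (hdim : ringKrullDim ((MvPolynomial (Fin m) K) ⧸
        Module.annihilator (MvPolynomial (Fin m) K)
          (M ⧸ Submodule.restrictScalars (MvPolynomial (Fin m) K)
            ((Ideal.span (Set.range (MvPolynomial.X :
                Fin n → MvPolynomial (Fin n) (MvPolynomial (Fin m) K)))) •
              (⊤ : Submodule (MvPolynomial (Fin n) (MvPolynomial (Fin m) K)) M)))) ≤ 1) :
    ∃ c : ℤ, ∃ j₀ : ℤ, ∀ j : ℤ, j ≤ j₀ →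
      CMreg K m ↥(Hy (MvPolynomial (Fin m) K) n σ φ (fun i s => (D i s).2) 0 j)
        (HyGr K m n σ φ D 0 j) ≤ c := by
  let _ : DirectSum.Decomposition ℳ := hdecomp.chooseDecomposition
  obtain ⟨g, r, d1, hgr, hgv, hs, hi⟩ := main_M ℳ hsmul (D 0) ε hsurj hεgr hdim
  refine ⟨max 0 (d1 + r), 0, fun j _ => ?_⟩
  have hrange : ∀ u, ε u = 0 → ∃ v, φ 0 v = u := fun u hu => (hexact₀ u).mp hu
  have hCsmul : ∀ (p : MvPolynomial (Fin m) K)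
      (u : σ 0 →₀ MvPolynomial (Fin n) (MvPolynomial (Fin m) K)),
      (C p : MvPolynomial (Fin n) (MvPolynomial (Fin m) K)) • u = p • u := by
    intro p u
    ext1 s
    rw [Finsupp.smul_apply, Finsupp.smul_apply, smul_eq_mul, C_mul']
  have hεsub : ∀ a b, ε (a - b) = ε a - ε b := fun a b => map_sub ε a b
  -- membership in the graded pieces
  have hmem : ∀ d (w : Emod (MvPolynomial (Fin m) K) n (σ 0)),
      w ∈ ystrand (MvPolynomial (Fin m) K) n (fun s => (D 0 s).2) j →
      w ∈ xstrandE K m n (fun s => (D 0 s).1) d →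
      ∃ x ∈ HyGr K m n σ φ D 0 j d,
        (x : _ ⧸ LinearMap.range (emap (MvPolynomial (Fin m) K) n (φ 0))) =
          Submodule.Quotient.mk w := by
    intro d w hy hx
    exact ⟨⟨Submodule.Quotient.mk w, w, ⟨trivial, hy⟩, rfl⟩, ⟨w, ⟨⟨trivial, hy⟩, hx⟩, rfl⟩, rfl⟩
  have hrep : ∀ d, ∀ x ∈ HyGr K m n σ φ D 0 j d,
      ∃ w ∈ ystrand (MvPolynomial (Fin m) K) n (fun s => (D 0 s).2) j,
        w ∈ xstrandE K m n (fun s => (D 0 s).1) d ∧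
        (x : _ ⧸ LinearMap.range (emap (MvPolynomial (Fin m) K) n (φ 0))) =
          Submodule.Quotient.mk w := by
    rintro d x ⟨w, ⟨⟨_, hy⟩, hx⟩, h⟩
    exact ⟨w, hy, hx, h.symm⟩
  apply CMreg_le K m _ _ g hgv r d1
  · intro l d x hx
    obtain ⟨w, hy, hx, h⟩ := hrep d x hx
    refine ⟨X l • w, ⟨⟨trivial, Submodule.smul_mem _ _ hy⟩, ?_⟩, ?_⟩
    · intro s c ν hν
      rw [Finsupp.smul_apply, smul_eq_mul, coeff_X_mul'] at hν
      split_ifs at hν with hl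
      · have h1 := hx s c _ hν
        have hle : Finsupp.single l 1 ≤ ν := by
          rw [Finsupp.single_le_iff]
          exact Nat.one_le_iff_ne_zero.mpr (Finsupp.mem_support_iff.mp hl)
        rw [tdeg_tsub hle, tdeg_eq_degree (Finsupp.single l 1), Finsupp.degree_single] at h1
        push_cast at h1
        linarith
      · exact absurd rfl hν
    · exact (congrArg (fun q => (X l : MvPolynomial (Fin m) K) • q) h).symm
  · intro d hd x hx
    obtain ⟨w, hy, hx, h⟩ := hrep d x hx
    obtain ⟨κ, hκ⟩ := exists_kappa w
    have hu := usec_FHom (D 0) κ w d j hy hx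
    have hw := Psi_usec κ w hκ
    set u := usec κ w
    obtain ⟨x', hx', hgx⟩ := hs d _ hd _ (eps_mem ℳ hsmul (D 0) ε hεgr u _ hu)
    obtain ⟨u', hu', rfl⟩ := exists_hom_of_mem ℳ hsmul (D 0) ε hsurj hεgr _ _ hx'
    obtain ⟨hy', hx''⟩ := Psi_strand (D 0) κ u' (d - r) j hu'
    obtain ⟨y, hy1, hy2⟩ := hmem _ _ hy' hx''
    refine ⟨y, hy1, Subtype.ext ?_⟩
    change g • y.1 = x.1
    rw [hy2, h]
    change Submodule.Quotient.mk (g • Psi κ u') = _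
    rw [Submodule.Quotient.eq]
    obtain ⟨v, hv⟩ := hrange ((C g : MvPolynomial (Fin n) (MvPolynomial (Fin m) K)) • u' - u)
      (by rw [hεsub, map_smul, hgx, sub_self])
    refine ⟨Psi κ v, ?_⟩
    rw [emap_Psi, hv, hCsmul, map_sub, map_smul, hw]
  · intro d hd x hx hgx
    obtain ⟨w, hy, hx, h⟩ := hrep d x hx
    have hg0 : g • w ∈ LinearMap.range (emap (MvPolynomial (Fin m) K) n (φ 0)) := by
      rw [← Submodule.Quotient.mk_eq_zero]
      change g • (Submodule.Quotient.mk w :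
        _ ⧸ LinearMap.range (emap (MvPolynomial (Fin m) K) n (φ 0))) = 0
      rw [← h]
      exact congrArg Subtype.val hgx
    obtain ⟨w', hw'⟩ := hg0
    obtain ⟨κ1, hκ1⟩ := exists_kappa w
    obtain ⟨κ2, hκ2⟩ := exists_kappa w'
    set κ := κ1 + κ2 with hκ
    have hu := usec_FHom (D 0) κ w d j hy hx
    have hw := Psi_usec κ w fun s c hc => (hκ1 s c hc).trans le_self_add
    have hwv := Psi_usec κ w' fun s c hc => (hκ2 s c hc).trans le_add_self
    set u := usec κ w
    set v := usec κ w'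
    have hem := eps_mem ℳ hsmul (D 0) ε hεgr u _ hu
    have hJ : (C g : MvPolynomial (Fin n) (MvPolynomial (Fin m) K)) • ε u ∈ JM K m M κ := by
      have h1 : Psi κ ((C g : MvPolynomial (Fin n) (MvPolynomial (Fin m) K)) • u - φ 0 v) = 0 := by
        rw [hCsmul, map_sub, map_smul, ← emap_Psi, hw, hwv, hw', sub_self]
      have h2 := JM_i ε κ _ h1
      rwa [hεsub, map_smul, hexact₀.apply_apply_eq_zero, sub_zero] at h2
    obtain ⟨z', hz1, hz2, hz3⟩ := JM_iii ℳ hsmul g r d1 hs κ _ hJ (d + r) (j + n + tdeg κ)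
      (by linarith [Int.natCast_nonneg r])
    have hgm := hsmul r 0 _ (isBihom_C (n := n) g r hgr) _ _ hem
    simp only [Nat.cast_zero, add_zero] at hgm
    rw [cmp_same ℳ hgm] at hz3
    rw [add_sub_cancel_right] at hz1
    have hz : ε u = z' := by
      rw [← sub_eq_zero]
      exact hi d _ hd _ (sub_mem hem hz1) (by rw [smul_sub, hz3, sub_self])
    rw [← hz] at hz2
    obtain ⟨v0, hv0, hv0'⟩ := JM_ii ε hsurj κ _ hz2
    obtain ⟨v1, hv1⟩ := hrange (u - v0) (by rw [hεsub, hv0, sub_self])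
    apply Subtype.ext
    change x.1 = 0
    rw [h, Submodule.Quotient.mk_eq_zero]
    exact ⟨Psi κ v1, by rw [emap_Psi, hv1, map_sub, hv0', sub_zero, hw]⟩

end Paper
end

section
/- Let K be a field of characteristic 0, P = K[x_1,…,x_n,y_1,…,y_n] bigraded with deg x_i = (1,0) and deg y_i = (0,1), P_+ = (y_1,…,y_n), n ≥ 2, and r ∈ ℕ. For λ = (λ_1,…,λ_n) ∈ K^n set f_λ = Σ_{i=1}^n λ_i x_i y_i. Then there exists a nonempty Zariski open subset V ⊆ K^n such that for all λ ∈ V and all j ≤ −n, reg H^n_{P_+}(P/f_λ^r P)_j = −n − j + r − 1. -/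
/-!
Formalization of a statement from "On the regularity of local cohomology of bigraded algebras"
(A. Rahimi). Here `P₀ = K[x₁,…,x_m]`, `P = P₀[y₁,…,yₙ]` is bigraded with `deg xᵢ = (1,0)`,
`deg yⱼ = (0,1)`, and `P₊ = (y₁,…,yₙ)`.  The top local cohomology `H^n_{P₊}(P)` is the free
`P₀`-module `⊕_c P₀ z^c` (`c : Fin n →₀ ℕ`, `z^c` of bidegree `(0, -n - |c|)`), on which a
bihomogeneous `f = Σ_β f_β y^β ∈ P` acts by the contraction `f ⬝ z^c = Σ_{β ≤ c} f_β z^{c-β}`.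
For a hypersurface ring `R = P/fP` this yields the exact presentation
`⊕_{|c| = -n-j+b} P₀(-a) z^c → ⊕_{|c| = -n-j} P₀ z^c → H^n_{P₊}(R)_j → 0`
(with `(a,b) = bideg f`), and `H^{n-1}_{P₊}(R)_j` is the kernel of the first map.
-/

open MvPolynomial

namespace Paper

variable (A : Type) [CommRing A] (n : ℕ)

variable (K : Type) [Field K] (m : ℕ)

/-- The `x`-degree-`i` strand of `Wmod` (coefficients homogeneous of degree `i`). -/
def strandW (i : ℤ) : Submodule K (Wmod (MvPolynomial (Fin m) K) n) where
  carrier := {w | ∀ c ν, MvPolynomial.coeff ν (w c) ≠ 0 → (tdeg ν : ℤ) = i}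
  add_mem' := by
    intro a b ha hb c ν h
    rw [Finsupp.add_apply, MvPolynomial.coeff_add] at h
    by_cases h1 : MvPolynomial.coeff ν (a c) ≠ 0
    · exact ha c ν h1
    · push_neg at h1
      exact hb c ν (by simpa [h1] using h)
  zero_mem' := by intro c ν h; simp at h
  smul_mem' := by
    intro k w hw c ν h
    rw [Finsupp.smul_apply, MvPolynomial.coeff_smul] at h
    exact hw c ν (right_ne_zero_of_smul h)

/-- The submodule `U_j ⊆ F_j = ⊕_{|c| = t} P₀ z^c` (`j = -n-t`): the image of
`⊕_{|c| = t+b} P₀(-a) z^c` under multiplication by `f` on `H^n_{P₊}(P)`. -/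
noncomputable def Uf (f : MvPolynomial (Fin n) (MvPolynomial (Fin m) K)) (t b : ℕ) :
    Submodule (MvPolynomial (Fin m) K) (Wmod (MvPolynomial (Fin m) K) n) :=
  Submodule.map (contract (MvPolynomial (Fin m) K) n f) (Fk (MvPolynomial (Fin m) K) n (t + b))

/-- The graded component `H^n_{P₊}(P/fP)_j`, `j = -n-t`, realized as the image of
`F_j = ⊕_{|c| = t} P₀ z^c` in `Wmod/U_j`; i.e. the cokernel `F_j/U_j` of the presentation. -/
noncomputable def topH (f : MvPolynomial (Fin n) (MvPolynomial (Fin m) K)) (t b : ℕ) :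
    Submodule (MvPolynomial (Fin m) K)
      ((Wmod (MvPolynomial (Fin m) K) n) ⧸ Uf n K m f t b) :=
  Submodule.map (Uf n K m f t b).mkQ (Fk (MvPolynomial (Fin m) K) n t)

/-- The `x`-degree-`i` component of `H^n_{P₊}(P/fP)_j`, `j = -n-t`, inside `Wmod/U_j`. -/
noncomputable def topHcomp (f : MvPolynomial (Fin n) (MvPolynomial (Fin m) K)) (t b : ℕ)
    (i : ℤ) : Submodule K ((Wmod (MvPolynomial (Fin m) K) n) ⧸ Uf n K m f t b) :=
  Submodule.map ((Uf n K m f t b).mkQ.restrictScalars K)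
    (strandW n K m i ⊓ (Fk (MvPolynomial (Fin m) K) n t).restrictScalars K)

/-- The grading (by `x`-degree) of `H^n_{P₊}(P/fP)_j`, `j = -n-t`. -/
noncomputable def topHgr (f : MvPolynomial (Fin n) (MvPolynomial (Fin m) K)) (t b : ℕ)
    (i : ℤ) : Submodule K ↥(topH n K m f t b) :=
  Submodule.comap ((topH n K m f t b).subtype.restrictScalars K) (topHcomp n K m f t b i)

/-- `H^{n-1}_{P₊}(P/fP)_j`, `j = -n-t`: the kernel of multiplication by `f` from
`⊕_{|c| = t+b} P₀(-a) z^c` to `⊕_{|c| = t} P₀ z^c`. -/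
noncomputable def syzM (f : MvPolynomial (Fin n) (MvPolynomial (Fin m) K)) (t b : ℕ) :
    Submodule (MvPolynomial (Fin m) K) (Wmod (MvPolynomial (Fin m) K) n) :=
  LinearMap.ker (contract (MvPolynomial (Fin m) K) n f) ⊓ Fk (MvPolynomial (Fin m) K) n (t + b)

/-- The grading of `H^{n-1}_{P₊}(P/fP)_j`, `j = -n-t`: since it lives inside
`⊕_{|c| = t+b} P₀(-a) z^c`, its degree-`i` component consists of the elements whose
coefficients are homogeneous of degree `i - a`. -/
noncomputable def syzGr (f : MvPolynomial (Fin n) (MvPolynomial (Fin m) K)) (t b a : ℕ)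
    (i : ℤ) : Submodule K ↥(syzM n K m f t b) :=
  Submodule.comap ((syzM n K m f t b).subtype.restrictScalars K) (strandW n K m (i - a))

/-- `f_λ = Σᵢ λᵢ xᵢ yᵢ ∈ P = K[x₁,…,xₙ][y₁,…,yₙ]`. -/
noncomputable def fLam {K : Type} [Field K] {n : ℕ} (l : Fin n → K) :
    MvPolynomial (Fin n) (MvPolynomial (Fin n) K) :=
  ∑ i : Fin n, MvPolynomial.C (MvPolynomial.C (l i) * MvPolynomial.X i) * MvPolynomial.X i

/-! ### Auxiliary material for the proof -/

lemma tdeg_add {n : ℕ} (a b : Fin n →₀ ℕ) : tdeg (a + b) = tdeg a + tdeg b := by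
  unfold tdeg
  exact Finsupp.sum_add_index' (fun _ => rfl) (fun _ _ _ => rfl)

lemma tdeg_single {n : ℕ} (i : Fin n) (k : ℕ) : tdeg (Finsupp.single i k) = k := by
  unfold tdeg
  exact Finsupp.sum_single_index rfl

lemma tdeg_eq_sum {n : ℕ} (a : Fin n →₀ ℕ) : tdeg a = ∑ i, a i := by
  unfold tdeg
  exact Finsupp.sum_fintype _ _ (fun _ => rfl)

lemma contract_apply {A : Type} [CommRing A] {n : ℕ} (f : MvPolynomial (Fin n) A)
    (w : Wmod A n) (d : Fin n →₀ ℕ) :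
    contract A n f w d = ∑ β ∈ f.support, coeff β f * w (d + β) := by
  classical
  induction w using Finsupp.induction_linear with
  | zero => simp
  | add u v hu hv => simp [hu, hv, mul_add, Finset.sum_add_distrib]
  | single c a =>
    simp only [contract, Finsupp.lsum_single, LinearMap.smulRight_apply, LinearMap.id_apply,
      Finsupp.smul_apply, Finsupp.finsetSum_apply, smul_eq_mul, Finset.mul_sum]
    refine Finset.sum_congr rfl fun β _ => ?_
    by_cases h : c = d + β
    · subst h
      simp [mul_comm]
    · have : ¬ (β ≤ c ∧ c - β = d) := by
        rintro ⟨h1, h2⟩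
        exact h (by rw [← h2, tsub_add_cancel_of_le h1])
      rw [Finsupp.single_apply, if_neg h]
      by_cases h1 : β ≤ c
      · have h2 : c - β ≠ d := fun h2 => this ⟨h1, h2⟩
        simp [h1, h2]
      · simp [h1]

lemma contract_apply_of_subset {A : Type} [CommRing A] {n : ℕ} (f : MvPolynomial (Fin n) A)
    (w : Wmod A n) (d : Fin n →₀ ℕ) (s : Finset (Fin n →₀ ℕ)) (hs : f.support ⊆ s) :
    contract A n f w d = ∑ β ∈ s, coeff β f * w (d + β) := by
  rw [contract_apply]
  refine Finset.sum_subset hs fun β _ h => ?_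
  rw [notMem_support_iff.1 h, zero_mul]

lemma contract_add {A : Type} [CommRing A] {n : ℕ} (f g : MvPolynomial (Fin n) A) :
    contract A n (f + g) = contract A n f + contract A n g := by
  classical
  refine LinearMap.ext fun w => Finsupp.ext fun d => ?_
  rw [LinearMap.add_apply, Finsupp.add_apply,
    contract_apply_of_subset f w d (f.support ∪ g.support) Finset.subset_union_left,
    contract_apply_of_subset g w d (f.support ∪ g.support) Finset.subset_union_right,
    contract_apply_of_subset (f + g) w d (f.support ∪ g.support) support_add,
    ← Finset.sum_add_distrib]
  simp [add_mul]

lemma contract_monomial {A : Type} [CommRing A] {n : ℕ} (β : Fin n →₀ ℕ) (a : A)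
    (w : Wmod A n) (d : Fin n →₀ ℕ) :
    contract A n (monomial β a) w d = a * w (d + β) := by
  classical
  rw [contract_apply_of_subset _ w d {β} support_monomial_subset]
  simp

lemma contract_mul {A : Type} [CommRing A] {n : ℕ} (f g : MvPolynomial (Fin n) A) (w : Wmod A n) :
    contract A n (f * g) w = contract A n f (contract A n g w) := by
  induction f using MvPolynomial.induction_on' with
  | add p q hp hq => rw [add_mul, contract_add, contract_add]; simp [hp, hq]
  | monomial u a =>
    induction g using MvPolynomial.induction_on' with
    | add p q hp hq => rw [mul_add, contract_add, contract_add]; simp [hp, hq]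
    | monomial v b =>
      ext1 d
      rw [monomial_mul, contract_monomial, contract_monomial, contract_monomial, add_assoc,
        mul_assoc]

lemma contract_one {A : Type} [CommRing A] {n : ℕ} (w : Wmod A n) :
    contract A n 1 w = w := by
  ext1 d
  have := contract_monomial (0 : Fin n →₀ ℕ) (1 : A) w d
  rw [monomial_zero', C_1] at this
  rw [this]; simp

lemma contract_fLam {K : Type} [Field K] {n : ℕ} (l : Fin n → K)
    (w : Wmod (MvPolynomial (Fin n) K) n) (d : Fin n →₀ ℕ) :
    contract (MvPolynomial (Fin n) K) n (fLam l) w d =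
      ∑ i, l i • (X i * w (d + Finsupp.single i 1)) := by
  have key : ∀ s : Finset (Fin n), contract (MvPolynomial (Fin n) K) n
      (∑ i ∈ s, C (C (l i) * X i) * X i) w d =
      ∑ i ∈ s, l i • (X i * w (d + Finsupp.single i 1)) := by
    classical
    intro s
    induction s using Finset.induction_on with
    | empty =>
      simp only [Finset.sum_empty]
      rw [contract_apply]; simp
    | insert a s ha ih =>
      rw [Finset.sum_insert ha, Finset.sum_insert ha, contract_add, LinearMap.add_apply,
        Finsupp.add_apply, ih]
      congr 1
      have h : (C (C (l a) * X a) * X a : MvPolynomial (Fin n) (MvPolynomial (Fin n) K)) =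
          monomial (Finsupp.single a 1) (C (l a) * X a) := by
        generalize (C (l a) * X a : MvPolynomial (Fin n) K) = b
        rw [X, C_mul_monomial, mul_one]
      rw [h, contract_monomial, smul_eq_C_mul, mul_assoc]
  exact key _

/-- The raising operator on families. -/
noncomputable def EE {K : Type} [Field K] {n : ℕ} (l : Fin n → K) :
    Module.End K ((Fin n →₀ ℕ) → MvPolynomial (Fin n) K) where
  toFun w d := ∑ i, l i • (X i * w (d + Finsupp.single i 1))
  map_add' u v := by
    funext d
    simp [mul_add, Finset.sum_add_distrib]
  map_smul' a v := by
    funext d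
    simp [Finset.smul_sum, smul_comm a]

/-- The lowering operator on families. -/
noncomputable def FF {K : Type} [Field K] {n : ℕ} (l : Fin n → K) :
    Module.End K ((Fin n →₀ ℕ) → MvPolynomial (Fin n) K) where
  toFun w d := ∑ j, ((l j)⁻¹ * (d j : K)) • pderiv j (w (d - Finsupp.single j 1))
  map_add' u v := by
    funext d
    simp [Finset.sum_add_distrib]
  map_smul' a v := by
    funext d
    simp [Finset.smul_sum, smul_comm a]

lemma contract_pow {K : Type} [Field K] {n : ℕ} (l : Fin n → K) (r : ℕ)
    (w : Wmod (MvPolynomial (Fin n) K) n) :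
    ⇑(contract (MvPolynomial (Fin n) K) n (fLam l ^ r) w) = (EE l ^ r) ⇑w := by
  induction r with
  | zero => simp [contract_one]
  | succ r ih =>
    rw [pow_succ', contract_mul, pow_succ', Module.End.mul_apply, ← ih]
    funext d
    rw [contract_fLam]
    rfl

lemma bracket {K : Type} [Field K] {n : ℕ} (l : Fin n → K) (hl : ∀ i, l i ≠ 0)
    (w : (Fin n →₀ ℕ) → MvPolynomial (Fin n) K) (d : Fin n →₀ ℕ) :
    EE l (FF l w) d = FF l (EE l w) d +
      ∑ i, (X i * pderiv i (w d) - (d i : K) • w d) := by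
  classical
  have h1 : EE l (FF l w) d = ∑ j, ∑ i, (l i * (l j)⁻¹ * (((d + Finsupp.single i 1 : Fin n →₀ ℕ) j : ℕ) : K)) •
      (X i * pderiv j (w (d + Finsupp.single i 1 - Finsupp.single j 1))) := by
    rw [Finset.sum_comm]
    simp only [EE, FF, LinearMap.coe_mk, AddHom.coe_mk, Finset.mul_sum, Finset.smul_sum,
      mul_smul_comm, smul_smul, mul_assoc]
  have h2 : FF l (EE l w) d = ∑ j, ∑ i, (l i * (l j)⁻¹ * (d j : K)) •
      (pderiv j (X i * (w (d - Finsupp.single j 1 + Finsupp.single i 1)))) := by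
    simp only [EE, FF, LinearMap.coe_mk, AddHom.coe_mk, map_sum, Finset.smul_sum,
      Derivation.map_smul, smul_smul]
    refine Finset.sum_congr rfl fun j _ => Finset.sum_congr rfl fun i _ => ?_
    congr 1; ring
  rw [h1, h2, ← Finset.sum_add_distrib]
  refine Finset.sum_congr rfl fun j _ => ?_
  rw [← Finset.add_sum_erase _ _ (Finset.mem_univ j),
    ← Finset.add_sum_erase (a := j) Finset.univ (fun i => (l i * (l j)⁻¹ * (d j : K)) •
      (pderiv j (X i * (w (d - Finsupp.single j 1 + Finsupp.single i 1))))) (Finset.mem_univ j),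
    add_right_comm]
  congr 1
  · rw [mul_inv_cancel₀ (hl j), add_tsub_cancel_right]
    by_cases hd : d j = 0
    · simp [hd]
    · have : d - Finsupp.single j 1 + Finsupp.single j 1 = d :=
        tsub_add_cancel_of_le (by simpa [Finsupp.single_le_iff] using Nat.one_le_iff_ne_zero.2 hd)
      rw [this]
      simp [add_smul, smul_add]
  · refine Finset.sum_congr rfl fun i hi => ?_
    have hij : i ≠ j := (Finset.mem_erase.1 hi).1
    by_cases hd : d j = 0
    · simp [hd, hij]
    · have : d - Finsupp.single j 1 + Finsupp.single i 1 =
          d + Finsupp.single i 1 - Finsupp.single j 1 :=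
        (tsub_add_eq_add_tsub
          (by simpa [Finsupp.single_le_iff] using Nat.one_le_iff_ne_zero.2 hd))
      rw [this]
      simp [hij, pderiv_X_of_ne hij]

/-- Bihomogeneous families of bidegree `(p, q)`. -/
def VV (K : Type) [Field K] (n : ℕ) (p q : ℤ) :
    Submodule K ((Fin n →₀ ℕ) → MvPolynomial (Fin n) K) where
  carrier := {w | ∀ c ν, coeff ν (w c) ≠ 0 → (tdeg ν : ℤ) = p ∧ (tdeg c : ℤ) = q}
  add_mem' := by
    intro a b ha hb c ν h
    rw [Pi.add_apply, coeff_add] at h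
    by_cases h1 : coeff ν (a c) = 0
    · exact hb c ν (by simpa [h1] using h)
    · exact ha c ν h1
  zero_mem' := by intro c ν h; simp at h
  smul_mem' := by
    intro k w hw c ν h
    rw [Pi.smul_apply, coeff_smul] at h
    exact hw c ν (right_ne_zero_of_smul h)

lemma EE_mem {K : Type} [Field K] {n : ℕ} (l : Fin n → K) {p q : ℤ}
    {w : (Fin n →₀ ℕ) → MvPolynomial (Fin n) K} (hw : w ∈ VV K n p q) :
    EE l w ∈ VV K n (p + 1) (q - 1) := by
  classical
  intro c ν h
  change coeff ν (∑ i, l i • (X i * w (c + Finsupp.single i 1))) ≠ 0 at h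
  rw [coeff_sum] at h
  obtain ⟨i, -, hi⟩ := Finset.exists_ne_zero_of_sum_ne_zero h
  rw [coeff_smul, coeff_X_mul'] at hi
  split_ifs at hi with hs
  · obtain ⟨h1, h2⟩ := hw _ _ (right_ne_zero_of_smul hi)
    rw [tdeg_add, tdeg_single] at h2
    have h3 : ν - Finsupp.single i 1 + Finsupp.single i 1 = ν :=
      tsub_add_cancel_of_le (by
        simpa [Finsupp.single_le_iff] using Nat.one_le_iff_ne_zero.2 (Finsupp.mem_support_iff.1 hs))
    rw [← h3, tdeg_add, tdeg_single]
    push_cast at h2 ⊢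
    omega
  · simp at hi

lemma FF_mem {K : Type} [Field K] {n : ℕ} (l : Fin n → K) {p q : ℤ}
    {w : (Fin n →₀ ℕ) → MvPolynomial (Fin n) K} (hw : w ∈ VV K n p q) :
    FF l w ∈ VV K n (p - 1) (q + 1) := by
  classical
  intro c ν h
  change coeff ν (∑ j, ((l j)⁻¹ * (c j : K)) • pderiv j (w (c - Finsupp.single j 1))) ≠ 0 at h
  rw [coeff_sum] at h
  obtain ⟨i, -, hi⟩ := Finset.exists_ne_zero_of_sum_ne_zero h
  rw [coeff_smul, coeff_pderiv] at hi
  obtain ⟨h1, h2⟩ := hw _ _ (left_ne_zero_of_mul (right_ne_zero_of_smul hi))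
  have hc : c i ≠ 0 := by
    intro h0
    rw [h0] at hi
    simp at hi
  have h3 : c - Finsupp.single i 1 + Finsupp.single i 1 = c :=
    tsub_add_cancel_of_le (by
      simpa [Finsupp.single_le_iff] using Nat.one_le_iff_ne_zero.2 hc)
  rw [tdeg_add, tdeg_single] at h1
  have h4 := congrArg tdeg h3
  rw [tdeg_add, tdeg_single] at h4
  push_cast at h1
  omega

lemma euler {K : Type} [Field K] {n : ℕ} {p q : ℤ}
    {w : (Fin n →₀ ℕ) → MvPolynomial (Fin n) K} (hw : w ∈ VV K n p q) (d : Fin n →₀ ℕ) :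
    ∑ i, (X i * pderiv i (w d) - (d i : K) • w d) = ((p - q : ℤ) : K) • w d := by
  classical
  ext ν
  have h1 : ∀ i, coeff ν (X i * pderiv i (w d) - (d i : K) • w d) =
      ((ν i : K) - (d i : K)) * coeff ν (w d) := by
    intro i
    rw [coeff_sub, coeff_smul, coeff_X_mul', coeff_pderiv, smul_eq_mul, sub_mul]
    congr 1
    split_ifs with hs
    · have hs' : 1 ≤ ν i := Nat.one_le_iff_ne_zero.2 (Finsupp.mem_support_iff.1 hs)
      have h3 : ν - Finsupp.single i 1 + Finsupp.single i 1 = ν :=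
        tsub_add_cancel_of_le (by simpa [Finsupp.single_le_iff] using hs')
      rw [h3, mul_comm]
      congr 1
      rw [Finsupp.tsub_apply, Finsupp.single_eq_same, Nat.cast_sub hs']
      simp
    · have : ν i = 0 := by simpa using hs
      simp [this]
  rw [coeff_sum, Finset.sum_congr rfl (fun i _ => h1 i), ← Finset.sum_mul, coeff_smul, smul_eq_mul]
  by_cases h : coeff ν (w d) = 0
  · simp [h]
  · obtain ⟨h2, h3⟩ := hw _ _ h
    rw [← h2, ← h3, tdeg_eq_sum, tdeg_eq_sum]
    simp [Finset.sum_sub_distrib]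

lemma EE_FF {K : Type} [Field K] {n : ℕ} (l : Fin n → K) (hl : ∀ i, l i ≠ 0) {p q : ℤ}
    {w : (Fin n →₀ ℕ) → MvPolynomial (Fin n) K} (hw : w ∈ VV K n p q) :
    EE l (FF l w) = FF l (EE l w) + ((p - q : ℤ) : K) • w := by
  funext d
  rw [bracket l hl, euler hw]
  rfl

lemma EE_EE_pow {K : Type} [Field K] {n : ℕ} (l : Fin n → K) (a : ℕ)
    (w : (Fin n →₀ ℕ) → MvPolynomial (Fin n) K) :
    EE l ((EE l ^ a) w) = (EE l ^ (a + 1)) w := by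
  rw [pow_succ', Module.End.mul_apply]

lemma EE_pow_EE {K : Type} [Field K] {n : ℕ} (l : Fin n → K) (a : ℕ)
    (w : (Fin n →₀ ℕ) → MvPolynomial (Fin n) K) :
    (EE l ^ a) (EE l w) = (EE l ^ (a + 1)) w := by
  rw [pow_succ, Module.End.mul_apply]

lemma EE_pow_mem {K : Type} [Field K] {n : ℕ} (l : Fin n → K) {p q : ℤ}
    {w : (Fin n →₀ ℕ) → MvPolynomial (Fin n) K} (hw : w ∈ VV K n p q) (a : ℕ) :
    (EE l ^ a) w ∈ VV K n (p + a) (q - a) := by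
  induction a with
  | zero => simpa using hw
  | succ a ih =>
    rw [pow_succ', Module.End.mul_apply]
    have := EE_mem l ih
    push_cast
    rwa [← add_assoc, ← sub_sub]

lemma EE_pow_FF {K : Type} [Field K] {n : ℕ} (l : Fin n → K) (hl : ∀ i, l i ≠ 0) {p q : ℤ}
    {w : (Fin n →₀ ℕ) → MvPolynomial (Fin n) K} (hw : w ∈ VV K n p q) (a : ℕ) :
    (EE l ^ (a + 1)) (FF l w) = FF l ((EE l ^ (a + 1)) w) +
      (((a + 1) * (p - q + a) : ℤ) : K) • (EE l ^ a) w := by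
  induction a with
  | zero => simpa using EE_FF l hl hw
  | succ a ih =>
    rw [← EE_EE_pow l (a + 1) (FF l w), ih, map_add, map_smul,
      EE_FF l hl (EE_pow_mem l hw (a + 1)), EE_EE_pow, EE_EE_pow, add_assoc, ← add_smul]
    congr 2
    push_cast
    ring

lemma lefschetz {K : Type} [Field K] [CharZero K] {n : ℕ} (l : Fin n → K) (hl : ∀ i, l i ≠ 0)
    (N : ℕ) : ∀ t : ℤ, t < N → ∀ r : ℕ, ∀ s : ℤ, t ≤ s → ∀ v ∈ VV K n (s + r) t,
      ∃ y ∈ VV K n s (t + r), (EE l ^ r) y = v := by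
  induction N with
  | zero =>
    intro t ht r s hs v hv
    refine ⟨0, zero_mem _, ?_⟩
    rw [map_zero]
    funext c
    ext ν
    by_contra h
    have := (hv c ν (fun h' => h (by rw [h']; rfl))).2
    push_cast at ht
    omega
  | succ N ihN =>
    intro t ht r
    induction r with
    | zero =>
      intro s hs v hv
      exact ⟨v, by simpa using hv, rfl⟩
    | succ r ihr =>
      intro s hs v hv
      obtain ⟨y, hy, hyv⟩ := ihr (s + 1) (by omega) v (by
        convert hv using 2; push_cast; ring)
      obtain ⟨y', hy', hyv'⟩ := ihN (t - 1) (by push_cast at ht; omega) (r + 2) s (by omega)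
        (EE l v) (by convert EE_mem l hv using 2; push_cast; ring)
      have e1 := EE_pow_FF l hl hy' (r + 1)
      have e2 := EE_pow_FF l hl hy r
      rw [hyv'] at e1
      rw [← EE_EE_pow l r y, hyv] at e2
      set c1 : K := ((((r + 1 : ℕ) + 1) * (s - (t - 1 + (r + 2 : ℕ)) + (r + 1 : ℕ)) : ℤ) : K)
        with hc1
      set c2 : K := (((r + 1) * (s + 1 - (t + r) + r) : ℤ) : K) with hc2
      have hc2' : c2 ≠ 0 := by
        rw [hc2]
        apply Int.cast_ne_zero.2
        have h1 : (0 : ℤ) < r + 1 := by positivity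
        have h2 : (0 : ℤ) < s + 1 - (t + r) + r := by linarith
        positivity
      refine ⟨c2⁻¹ • (FF l y - EE l (FF l y') + c1 • y'), ?_, ?_⟩
      · refine Submodule.smul_mem _ _ (add_mem (sub_mem ?_ ?_) (Submodule.smul_mem _ _ ?_))
        · convert FF_mem l hy using 2 <;> push_cast <;> ring
        · convert EE_mem l (FF_mem l hy') using 2 <;> push_cast <;> ring
        · convert hy' using 2; push_cast; ring
      · rw [map_smul, map_add, map_sub, map_smul, e2, EE_pow_EE, e1]
        rw [inv_smul_eq_iff₀ hc2']
        abel

lemma finite_tdeg {n : ℕ} (k : ℕ) : {c : Fin n →₀ ℕ | tdeg c = k}.Finite := by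
  refine (Set.finite_Iic (Finsupp.equivFunOnFinite.symm fun _ : Fin n => k)).subset ?_
  intro c hc i
  have hc' : tdeg c = k := hc
  rw [tdeg_eq_sum] at hc'
  change c i ≤ k
  rw [← hc']
  exact Finset.single_le_sum (f := fun i => c i) (fun _ _ => Nat.zero_le _) (Finset.mem_univ i)

lemma mem_Uf {K : Type} [Field K] [CharZero K] {n : ℕ} (l : Fin n → K) (hl : ∀ i, l i ≠ 0)
    (t r : ℕ) (e : ℤ) (he : (t : ℤ) + r ≤ e) (w : Wmod (MvPolynomial (Fin n) K) n)
    (h1 : w ∈ strandW n K n e) (h2 : w ∈ Fk (MvPolynomial (Fin n) K) n t) :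
    w ∈ Uf n K n (fLam l ^ r) t r := by
  have hw : (⇑w : (Fin n →₀ ℕ) → MvPolynomial (Fin n) K) ∈ VV K n (e - r + r) t := by
    intro c ν h
    refine ⟨by rw [h1 c ν h]; ring, ?_⟩
    have hc : c ∈ w.support := by
      rw [Finsupp.mem_support_iff]
      intro h0
      rw [h0] at h
      simp at h
    have : tdeg c = t := ((Finsupp.mem_supported _ _).1 h2) hc
    exact_mod_cast this
  obtain ⟨y, hy, hyw⟩ := lefschetz l hl (t + 1) t (by push_cast; omega) r (e - r) (by omega) _ hw
  have hsupp : Function.support y ⊆ {c : Fin n →₀ ℕ | tdeg c = t + r} := by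
    intro c hc
    obtain ⟨ν, hν⟩ := MvPolynomial.ne_zero_iff.1 (Function.mem_support.1 hc)
    have := (hy c ν hν).2
    exact_mod_cast this
  refine ⟨Finsupp.ofSupportFinite y ((finite_tdeg (t + r)).subset hsupp), ?_, ?_⟩
  · refine (Finsupp.mem_supported _ _).2 ?_
    intro c hc
    exact hsupp (by simpa [Finsupp.ofSupportFinite] using hc)
  · apply DFunLike.coe_injective
    rw [contract_pow]
    exact hyw

/-- truncated homogeneous forms in two elements -/
noncomputable def GG {K B : Type} [Field K] [CommRing B] [Algebra K B] (u v : B) (t : ℕ)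
    (a : ℕ → K) (N : ℕ) : B :=
  ∑ k ∈ Finset.range (t + 1), a k • (u ^ k * v ^ (N - k))

lemma GG_step {K B : Type} [Field K] [CommRing B] [Algebra K B] (u v : B) (s : K) (b : ℕ → K) :
    ∃ a : ℕ → K, a 0 = b 0 ∧ ∀ N m : ℕ, m ≤ N →
      (v + s • u) * GG u v m a N = GG u v m b (N + 1) + (s * a m) • (u ^ (m + 1) * v ^ (N - m)) := by
  let a : ℕ → K := fun k => Nat.rec (b 0) (fun k x => b (k + 1) - s * x) k
  have ha : ∀ k, a (k + 1) = b (k + 1) - s * a k := fun k => rfl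
  refine ⟨a, rfl, fun N m => ?_⟩
  induction m with
  | zero =>
    intro _
    have h0 : a 0 = b 0 := rfl
    simp only [GG, zero_add, Finset.sum_range_one, h0, pow_zero, one_mul, Nat.sub_zero, pow_one,
      Algebra.smul_def, map_mul]
    ring
  | succ m ih =>
    intro hm
    have ih' := ih (by omega)
    obtain ⟨M, rfl⟩ := Nat.exists_eq_add_of_le hm
    rw [GG] at ih' ⊢
    rw [Finset.sum_range_succ, mul_add, ih', GG, GG, Finset.sum_range_succ _ (m + 1), ha]
    have e1 : m + 1 + M - (m + 1) = M := by omega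
    have e2 : m + 1 + M - m = M + 1 := by omega
    have e3 : m + 1 + M + 1 - (m + 1) = M + 1 := by omega
    rw [e1, e2, e3]
    simp only [Algebra.smul_def, map_mul, map_sub]
    ring

lemma GG_pow {K B : Type} [Field K] [CommRing B] [Algebra K B] (u v : B) (s : K) (t r : ℕ) :
    ∀ b : ℕ → K, ∃ a : ℕ → K, a 0 = b 0 ∧ ∃ Q : B,
      (v + s • u) ^ r * GG u v t a t = GG u v t b (t + r) + u ^ (t + 1) * Q := by
  induction r with
  | zero => exact fun b => ⟨b, rfl, 0, by simp⟩
  | succ r ih =>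
    intro b
    obtain ⟨b', hb', h'⟩ := GG_step u v s b
    obtain ⟨a, ha, Q, hQ⟩ := ih b'
    refine ⟨a, ha.trans hb', (s * b' t) • v ^ (t + r - t) + (v + s • u) * Q, ?_⟩
    rw [pow_succ', mul_assoc, hQ, mul_add, h' (t + r) t (by omega), mul_add, mul_smul_comm,
      add_assoc t r 1]
    ring

/-- Polynomials without monomials dividing `x^γ`. -/
def JJ (K : Type) [Field K] {n : ℕ} (γ : Fin n →₀ ℕ) : Ideal (MvPolynomial (Fin n) K) where
  carrier := {a | ∀ ν ≤ γ, coeff ν a = 0}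
  add_mem' := by
    intro a b ha hb ν hν
    rw [coeff_add, ha ν hν, hb ν hν, add_zero]
  zero_mem' := by intro ν _; simp
  smul_mem' := by
    classical
    intro c a ha ν hν
    rw [smul_eq_mul, coeff_mul]
    refine Finset.sum_eq_zero fun x hx => ?_
    rw [ha x.2 (le_trans ?_ hν), mul_zero]
    rw [← Finset.HasAntidiagonal.mem_antidiagonal.1 hx]
    exact le_add_self

lemma X_pow_mem_JJ {K : Type} [Field K] {n : ℕ} (γ : Fin n →₀ ℕ) (i : Fin n) (k : ℕ)
    (hk : γ i < k) : (X i ^ k : MvPolynomial (Fin n) K) ∈ JJ K γ := by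
  classical
  intro ν hν
  rw [coeff_X_pow, if_neg]
  rintro rfl
  have := hν i
  simp at this
  omega

lemma u_pow_mem {K : Type} [Field K] {n : ℕ} (γ : Fin n →₀ ℕ) (i : Fin n) (k : ℕ)
    (hk : γ i < k) :
    ((C (X i) * X i) ^ k : MvPolynomial (Fin n) (MvPolynomial (Fin n) K)) ∈
      Ideal.map C (JJ K γ) := by
  rw [mul_pow, ← C_pow]
  exact Ideal.mul_mem_right _ _ (Ideal.mem_map_of_mem _ (X_pow_mem_JJ γ i k hk))

lemma contract_zero {A : Type} [CommRing A] {n : ℕ} :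
    contract A n 0 = 0 := by
  ext w d
  simp [contract_apply]

lemma contract_sum {A ι : Type} [CommRing A] {n : ℕ} (s : Finset ι)
    (g : ι → MvPolynomial (Fin n) A) (w : Wmod A n) (d : Fin n →₀ ℕ) :
    contract A n (∑ i ∈ s, g i) w d = ∑ i ∈ s, contract A n (g i) w d := by
  classical
  induction s using Finset.induction_on with
  | empty => simp [contract_zero]
  | insert a s ha ih =>
    rw [Finset.sum_insert ha, Finset.sum_insert ha, contract_add, LinearMap.add_apply,
      Finsupp.add_apply, ih]

lemma fLam_eq {K : Type} [Field K] {n : ℕ} (l : Fin n → K) :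
    fLam l = ∑ i, l i • (C (X i) * X i : MvPolynomial (Fin n) (MvPolynomial (Fin n) K)) := by
  unfold fLam
  refine Finset.sum_congr rfl fun i _ => ?_
  rw [← smul_mul_assoc, ← smul_eq_C_mul (X i) (l i)]
  congr 1
  rw [← monomial_zero', smul_monomial]

lemma smul_u_eq {K : Type} [Field K] {n : ℕ} (c : K) (p q : Fin n) (k j : ℕ) :
    c • ((C (X p) * X p) ^ k * (C (X q) * X q) ^ j :
      MvPolynomial (Fin n) (MvPolynomial (Fin n) K)) =
      monomial (Finsupp.single p k + Finsupp.single q j) (c • (X p ^ k * X q ^ j)) := by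
  rw [← smul_monomial]
  congr 1
  generalize (X p : MvPolynomial (Fin n) K) = a
  generalize (X q : MvPolynomial (Fin n) K) = b
  rw [mul_pow, mul_pow, X_pow_eq_monomial, X_pow_eq_monomial, ← C_pow, ← C_pow, C_mul_monomial,
    C_mul_monomial, monomial_mul, mul_one, mul_one]

lemma exists_not_mem_Uf {K : Type} [Field K] {n : ℕ} (l : Fin n → K) (hl : ∀ i, l i ≠ 0)
    (p q : Fin n) (hpq : p ≠ q) (t r : ℕ) (hr : 1 ≤ r) :
    ∃ w ∈ strandW n K n ((t : ℤ) + r - 1), w ∈ Fk (MvPolynomial (Fin n) K) n t ∧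
      w ∉ Uf n K n (fLam l ^ r) t r := by
  classical
  set γ : Fin n →₀ ℕ := Finsupp.single p t + Finsupp.single q (t + (r - 1)) with hγ
  have γp : γ p = t := by simp [hγ, hpq]
  have γq : γ q = t + (r - 1) := by simp [hγ, hpq.symm]
  have γi : ∀ i, i ≠ p → i ≠ q → γ i = 0 := fun i h1 h2 => by
    simp [hγ, h1, h2]
  let u : Fin n → MvPolynomial (Fin n) (MvPolynomial (Fin n) K) := fun i => C (X i) * X i
  obtain ⟨a, ha, Q, hQ⟩ := GG_pow (u p) (u q) (l p / l q) t r (fun k => if k = 0 then 1 else 0)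
  set g := GG (u p) (u q) t a t with hg
  set I := Ideal.map (C : _ →+* MvPolynomial (Fin n) (MvPolynomial (Fin n) K)) (JJ K γ) with hI
  have hGb : GG (u p) (u q) t (fun k => if k = 0 then (1 : K) else 0) (t + r) = u q ^ (t + r) := by
    unfold GG
    rw [Finset.sum_eq_single 0]
    · simp
    · intro b _ hb; simp [hb]
    · simp
  have hsm : ∀ (c : K) (x : MvPolynomial (Fin n) (MvPolynomial (Fin n) K)), x ∈ I → c • x ∈ I := by
    intro c x hx
    rw [Algebra.smul_def]
    exact Ideal.mul_mem_left _ _ hx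
  set f' := l q • (u q + (l p / l q) • u p) with hf'
  have hf'g : f' ^ r * g ∈ I := by
    rw [hf', smul_pow, smul_mul_assoc, hQ, hGb]
    refine hsm _ _ (add_mem (u_pow_mem γ q _ (by omega)) (Ideal.mul_mem_right _ _
      (u_pow_mem γ p _ (by omega))))
  have hff' : fLam l - f' ∈ I := by
    have : fLam l - f' = ∑ i ∈ (Finset.univ.erase p).erase q, l i • u i := by
      rw [fLam_eq, ← Finset.add_sum_erase _ _ (Finset.mem_univ p),
        ← Finset.add_sum_erase (Finset.univ.erase p) _
          (Finset.mem_erase.2 ⟨hpq.symm, Finset.mem_univ q⟩), hf', smul_add, smul_smul,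
        mul_div_cancel₀ _ (hl q)]
      simp only [u]
      abel
    rw [this]
    refine sum_mem fun i hi => hsm _ _ ?_
    simp only [Finset.mem_erase] at hi
    have := u_pow_mem (K := K) γ i 1 (by rw [γi i hi.2.1 hi.1]; exact one_pos)
    rwa [pow_one] at this
  have hfg : g * fLam l ^ r ∈ I := by
    have h1 : fLam l ^ r - f' ^ r ∈ I :=
      Ideal.mem_of_dvd _ (sub_dvd_pow_sub_pow _ _ r) hff'
    have h2 := add_mem (Ideal.mul_mem_right g _ h1) hf'g
    have h3 : (fLam l ^ r - f' ^ r) * g + f' ^ r * g = g * fLam l ^ r := by ring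
    rwa [h3] at h2
  refine ⟨Finsupp.single (Finsupp.single q t)
    (monomial (Finsupp.single p t + Finsupp.single q (r - 1)) 1), ?_, ?_, ?_⟩
  · intro c ν h
    rw [Finsupp.single_apply] at h
    split_ifs at h with hc
    · rw [coeff_monomial] at h
      split_ifs at h with hν
      · rw [← hν, tdeg_add, tdeg_single, tdeg_single]
        omega
      · simp at h
    · simp at h
  · exact Finsupp.single_mem_supported _ _ (tdeg_single q t)
  · rintro ⟨y, -, hy⟩
    have key : coeff γ (contract _ n g (contract _ n (fLam l ^ r) y) 0) = 0 := by
      rw [← contract_mul, contract_apply]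
      have : ∑ β ∈ (g * fLam l ^ r).support, coeff β (g * fLam l ^ r) * y (0 + β) ∈ JJ K γ :=
        sum_mem fun β _ => Ideal.mul_mem_right _ _ (mem_map_C_iff.1 hfg β)
      exact this γ le_rfl
    rw [hy, hg, GG, contract_sum, Finset.sum_eq_single 0] at key
    · rw [smul_u_eq, contract_monomial, pow_zero, one_mul, Finsupp.single_zero, zero_add, zero_add,
        Nat.sub_zero, Finsupp.single_eq_same, smul_mul_assoc, X_pow_eq_monomial, monomial_mul,
        coeff_smul, coeff_monomial, if_pos, ha] at key
      · simp at key
      · rw [hγ, Finsupp.single_add]; abel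
    · intro k hk hk0
      rw [smul_u_eq, contract_monomial, zero_add, Finsupp.single_apply, if_neg, mul_zero]
      intro h
      have := DFunLike.congr_fun h p
      simp [hpq] at this
      omega
    · simp

lemma topHgr_eq_bot {K : Type} [Field K] [CharZero K] {n : ℕ} (l : Fin n → K)
    (hl : ∀ i, l i ≠ 0) (t r : ℕ) (e : ℤ) (he : (t : ℤ) + r ≤ e) :
    topHgr n K n (fLam l ^ r) t r e = ⊥ := by
  rw [eq_bot_iff]
  rintro ⟨x, hx⟩ hx'
  obtain ⟨w, ⟨h1, h2⟩, h3⟩ := hx'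
  rw [Submodule.mem_bot]
  apply Subtype.ext
  change x = 0
  have h3' : (Uf n K n (fLam l ^ r) t r).mkQ w = x := h3
  rw [← h3', Submodule.mkQ_apply, Submodule.Quotient.mk_eq_zero]
  exact mem_Uf l hl t r e he w h1 h2

lemma X_smul_mem_strandW {K : Type} [Field K] {n : ℕ} (i : Fin n) (e : ℤ)
    (w : Wmod (MvPolynomial (Fin n) K) n) (hw : w ∈ strandW n K n e) :
    (X i : MvPolynomial (Fin n) K) • w ∈ strandW n K n (e + 1) := by
  classical
  intro c ν h
  rw [Finsupp.smul_apply, smul_eq_mul, coeff_X_mul'] at h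
  split_ifs at h with hs
  · have h1 := hw _ _ h
    have h3 : ν - Finsupp.single i 1 + Finsupp.single i 1 = ν :=
      tsub_add_cancel_of_le (by
        simpa [Finsupp.single_le_iff] using Nat.one_le_iff_ne_zero.2 (Finsupp.mem_support_iff.1 hs))
    rw [← h3, tdeg_add, tdeg_single]
    push_cast
    omega
  · simp at h

lemma exists_socle {K : Type} [Field K] [CharZero K] {n : ℕ} (hn : 2 ≤ n) (l : Fin n → K)
    (hl : ∀ i, l i ≠ 0) (t r : ℕ) (hr : 1 ≤ r) :
    ∃ v : ↥(topH n K n (fLam l ^ r) t r), v ∈ topHgr n K n (fLam l ^ r) t r ((t : ℤ) + r - 1) ∧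
      v ≠ 0 ∧ ∀ i : Fin n, (X i : MvPolynomial (Fin n) K) • v = 0 := by
  obtain ⟨w, h1, h2, h3⟩ := exists_not_mem_Uf l hl ⟨0, by omega⟩ ⟨1, by omega⟩ (by simp) t r hr
  refine ⟨⟨(Uf n K n (fLam l ^ r) t r).mkQ w, Submodule.mem_map_of_mem h2⟩, ?_, ?_, ?_⟩
  · exact ⟨w, ⟨h1, h2⟩, rfl⟩
  · intro h0
    have h0' := congrArg Subtype.val h0
    change (Uf n K n (fLam l ^ r) t r).mkQ w = 0 at h0'
    rw [Submodule.mkQ_apply, Submodule.Quotient.mk_eq_zero] at h0'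
    exact h3 h0'
  · intro i
    apply Subtype.ext
    change (X i : MvPolynomial (Fin n) K) • (Uf n K n (fLam l ^ r) t r).mkQ w = 0
    rw [← map_smul, Submodule.mkQ_apply, Submodule.Quotient.mk_eq_zero]
    exact mem_Uf l hl t r _ (by omega) _ (X_smul_mem_strandW i _ w h1) (Submodule.smul_mem _ _ h2)

lemma CMreg_eq_of_socle {K : Type} [Field K] {m : ℕ} (hm : 1 ≤ m)
    {N : Type} [AddCommGroup N] [Module (MvPolynomial (Fin m) K) N]
    [Module K N] [IsScalarTower K (MvPolynomial (Fin m) K) N]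
    (ℬ : ℤ → Submodule K N) (D : ℤ) (h1 : ∀ e, D < e → ℬ e = ⊥)
    (v : N) (hv : v ∈ ℬ D) (hv0 : v ≠ 0)
    (hX : ∀ i : Fin m, (X i : MvPolynomial (Fin m) K) • v = 0) :
    CMreg K m N ℬ = D := by
  classical
  refine IsGreatest.csSup_eq ⟨?_, ?_⟩
  · refine ⟨m, ?_⟩
    intro hbot
    let S0 : {S : Finset (Fin m) // S.card = m} := ⟨Finset.univ, by simp⟩
    have hmem : (Finsupp.single S0 v) ∈ kosStrand K m N ℬ m (D + m) ⊓
        (kosKer K m N m).restrictScalars K := by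
      refine ⟨?_, ?_⟩
      · intro S
        rw [add_sub_cancel_right, Finsupp.single_apply]
        split_ifs
        · exact hv
        · exact zero_mem _
      · obtain ⟨k, rfl⟩ := Nat.exists_eq_add_of_le' hm
        change kosD K (k + 1) N k (Finsupp.single S0 v) = 0
        rw [kosD, Finsupp.lsum_single, LinearMap.sum_apply]
        refine Finset.sum_eq_zero fun i _ => ?_
        simp [hX]
    have hz := (Submodule.eq_bot_iff _).1 hbot _ (Submodule.mem_map_of_mem hmem)
    change (LinearMap.range (kosD K m N m)).mkQ (Finsupp.single S0 v) = 0 at hz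
    rw [Submodule.mkQ_apply, Submodule.Quotient.mk_eq_zero] at hz
    obtain ⟨z, hz⟩ := hz
    have hz0 : z = 0 := by
      ext S
      exfalso
      have := Finset.card_le_univ S.1
      rw [S.2, Fintype.card_fin] at this
      omega
    rw [hz0, map_zero] at hz
    exact hv0 (Finsupp.single_eq_zero.1 hz.symm)
  · rintro e ⟨i, hi⟩
    by_contra hlt
    apply hi
    rw [Submodule.eq_bot_iff]
    rintro x ⟨w, ⟨hw, -⟩, rfl⟩
    have : w = 0 := by
      ext S
      have := hw S
      rw [add_sub_cancel_right, h1 e (not_le.1 hlt), Submodule.mem_bot] at this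
      exact this
    rw [this, map_zero]

/-- **Theorem (paper, Theorem 4.1).** Let `char K = 0`, `n ≥ 2`, `r ≥ 1` and
`f_λ = Σᵢ λᵢ xᵢ yᵢ`.  There is a nonempty Zariski open subset `V ⊆ K^n` such that
`reg H^n_{P₊}(P/f_λ^r P)_j = -n - j + r - 1` for all `λ ∈ V` and all `j ≤ -n`
(writing `j = -n - t`, `t ∈ ℕ`, the right-hand side is `t + r - 1`). -/
theorem regularity_of_top_local_cohomology_of_powers_of_generic_linear_form
    (K : Type) [Field K] [CharZero K] (n r : ℕ) (hn : 2 ≤ n) (hr : 1 ≤ r) :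
    ∃ V : Set (Fin n → K),
      (∃ S : Set (MvPolynomial (Fin n) K),
        V = {l | ∃ g ∈ S, MvPolynomial.eval l g ≠ 0}) ∧
      V.Nonempty ∧
      ∀ l ∈ V, ∀ t : ℕ,
        CMreg K n ↥(topH n K n (fLam l ^ r) t r) (topHgr n K n (fLam l ^ r) t r) =
          (t : ℤ) + r - 1 := by

  refine ⟨{l | ∃ g ∈ ({∏ i, X i} : Set (MvPolynomial (Fin n) K)), MvPolynomial.eval l g ≠ 0},
    ⟨_, rfl⟩, ⟨fun _ => 1, ?_⟩, ?_⟩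
  · exact ⟨_, rfl, by simp⟩
  · rintro l ⟨g, hg, hl⟩ t
    rw [Set.mem_singleton_iff.1 hg, map_prod] at hl
    have hl' : ∀ i, l i ≠ 0 := fun i => by
      have := Finset.prod_ne_zero_iff.1 hl i (Finset.mem_univ i)
      rwa [eval_X] at this
    obtain ⟨v, h1, h2, h3⟩ := exists_socle hn l hl' t r hr
    exact CMreg_eq_of_socle (by omega) _ _
      (fun e he => topHgr_eq_bot l hl' t r e (by omega)) v h1 h2 h3

end Paper
end
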